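/- arXiv:2001.00743 — 2 statements merged into one kernel-verified Lean document; each statement's English description precedes it below -/
import Mathlib

section
/- Let k ≥ 3, 1 ≤ a ≤ k−1, m ≥ 1, and let V^λ be an irreducible highest weight U_q(sl_k)-module with highest weight λ = mω_a and highest weight vector v_λ. For 0 ≤ j ≤ m, set v_j := f_{k−1}^{(j)} ⋯ f_a^{(j)} v_λ. Then the U_q(sl_{k−1})-submodule U_q(sl_{k−1}) v_j of V^λ is isomorphic, as a U_q(sl_{k−1})-module, to the irreducible highest weight U_q(sl_{k−1})-module with highest weight λ^j := j ω′_{a−1} + (m−j) ω′_a, where ω′_1, …, ω′_{k−2} are the fundamental weights of sl_{k−1} and by convention ω′_0 = 0 and ω′_{k−1} = 0. -/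
/-!
Common setup: the quantum group `U_q(sl_k)` (presented by generators
`e_i, f_i, K_i = q^{h_i}, K_i⁻¹` for `1 ≤ i ≤ k-1` and the standard relations)
over the field `KK = ℚ(q)`, and the notion of an irreducible highest weight
module.  Weights are recorded as functions `μ : ℕ → ℤ`, `μ i` being the value
`μ(h_i)` on the `i`-th simple coroot.
-/

noncomputable section
namespace QSL

abbrev KK : Type := RatFunc ℚ

/-- the variable `q`. -/
def qv : KK := RatFunc.X

/-- the quantum integer `[n]_q = (qⁿ - q⁻ⁿ)/(q - q⁻¹)`. -/
def qInt (n : ℕ) : KK := (qv ^ n - qv⁻¹ ^ n) / (qv - qv⁻¹)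

/-- the quantum factorial `[n]_q!`. -/
def qFact : ℕ → KK
  | 0 => 1
  | n + 1 => qFact n * qInt (n + 1)

/-- the Gaussian binomial coefficient `[m choose j]_q`. -/
def qBinom (m j : ℕ) : KK :=
  (∏ t ∈ Finset.range j, qInt (m - t)) / (∏ t ∈ Finset.range j, qInt (j - t))

/-- the Cartan matrix of `sl`:  `cartan i j = αⱼ(h_i)`. -/
def cartan (i j : ℕ) : ℤ := if i = j then 2 else if i + 1 = j ∨ j + 1 = i then -1 else 0

/-- The quantum group with `d` nodes (`d = k - 1` for `U_q(sl_k)`): a unital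
associative `ℚ(q)`-algebra generated by elements `e i, f i, K i, Kinv i`
(`1 ≤ i ≤ d`, where `K i = q^{h_i}`) subject to the standard relations. -/
structure QGroup (d : ℕ) where
  U : Type
  [ring : Ring U]
  [alg : Algebra KK U]
  e : ℕ → U
  f : ℕ → U
  K : ℕ → U
  Kinv : ℕ → U
  K_mul_Kinv : ∀ i, 1 ≤ i → i ≤ d → K i * Kinv i = 1
  Kinv_mul_K : ∀ i, 1 ≤ i → i ≤ d → Kinv i * K i = 1
  K_comm : ∀ i j, 1 ≤ i → i ≤ d → 1 ≤ j → j ≤ d → K i * K j = K j * K i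
  K_e_Kinv : ∀ i j, 1 ≤ i → i ≤ d → 1 ≤ j → j ≤ d →
      K i * e j * Kinv i = (qv ^ cartan i j) • e j
  K_f_Kinv : ∀ i j, 1 ≤ i → i ≤ d → 1 ≤ j → j ≤ d →
      K i * f j * Kinv i = (qv ^ (-cartan i j)) • f j
  e_f_comm : ∀ i j, 1 ≤ i → i ≤ d → 1 ≤ j → j ≤ d →
      e i * f j - f j * e i = if i = j then (qv - qv⁻¹)⁻¹ • (K i - Kinv i) else 0
  serre_e : ∀ i j, 1 ≤ i → i ≤ d → 1 ≤ j → j ≤ d → (i + 1 = j ∨ j + 1 = i) →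
      e i * e i * e j - (qv + qv⁻¹) • (e i * e j * e i) + e j * e i * e i = 0
  serre_f : ∀ i j, 1 ≤ i → i ≤ d → 1 ≤ j → j ≤ d → (i + 1 = j ∨ j + 1 = i) →
      f i * f i * f j - (qv + qv⁻¹) • (f i * f j * f i) + f j * f i * f i = 0
  comm_e : ∀ i j, 1 ≤ i → i ≤ d → 1 ≤ j → j ≤ d → (i + 1 < j ∨ j + 1 < i) →
      e i * e j = e j * e i
  comm_f : ∀ i j, 1 ≤ i → i ≤ d → 1 ≤ j → j ≤ d → (i + 1 < j ∨ j + 1 < i) →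
      f i * f j = f j * f i
  gen : ∀ x : U, x ∈ Algebra.adjoin KK
      {y : U | ∃ i, 1 ≤ i ∧ i ≤ d ∧ (y = e i ∨ y = f i ∨ y = K i ∨ y = Kinv i)}

attribute [instance] QGroup.ring QGroup.alg

variable {d : ℕ} (G : QGroup d)

/-- the divided power `f_i^{(n)} = f_iⁿ/[n]_q!`. -/
def fDiv (i n : ℕ) : G.U := (qFact n)⁻¹ • (G.f i) ^ n

/-- the divided power `e_i^{(n)} = e_iⁿ/[n]_q!`. -/
def eDiv (i n : ℕ) : G.U := (qFact n)⁻¹ • (G.e i) ^ n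

variable {V : Type} [AddCommGroup V] [Module KK V] [Module G.U V] [IsScalarTower KK G.U V]

/-- `u` is a weight vector of weight `μ` (recorded via `μ i = μ(h_i)`). -/
def IsWtVec (u : V) (μ : ℕ → ℤ) : Prop :=
  ∀ i, 1 ≤ i → i ≤ d → G.K i • u = (qv ^ μ i) • u

/-- `V` is an irreducible highest weight module over `G` with highest weight
`lam` and highest weight vector `v`: it is finite dimensional over `ℚ(q)`,
has a weight space decomposition, `v` is a nonzero weight vector of weight
`lam` annihilated by the `e_i`, `V` is generated by `v`, and `V` is
irreducible. -/
structure IsHWModule (lam : ℕ → ℤ) (v : V) : Prop where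
  findim : FiniteDimensional KK V
  ne_zero : v ≠ 0
  wt : IsWtVec G v lam
  hw : ∀ i, 1 ≤ i → i ≤ d → G.e i • v = 0
  gen : ∀ w : V, ∃ p : G.U, p • v = w
  irred : ∀ W : Submodule G.U V, W = ⊥ ∨ W = ⊤
  decomp : Submodule.span KK {u : V | ∃ μ : ℕ → ℤ, IsWtVec G u μ} = ⊤

/-- the weight `m ω_a`. -/
def omWt (a m : ℕ) : ℕ → ℤ := fun i => if i = a then (m : ℤ) else 0

/-- the weight `j ω_{a-1} + (m - j) ω_a`. -/
def hookWt (a m j : ℕ) : ℕ → ℤ := fun i =>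
  (if i = a - 1 then (j : ℤ) else 0) + (if i = a then (m : ℤ) - (j : ℤ) else 0)

/-- `f_{a'}^{(c_{a'})} ⋯ f_{a+1}^{(c_{a+1})} f_a^{(c_a)} • v`. -/
def fDivChain (c : ℕ → ℕ) (a a' : ℕ) (v : V) : V :=
  (List.range (a' + 1 - a)).foldl (fun u r => fDiv G (a + r) (c (a + r)) • u) v

/-- the generators `e_i, f_i, K_i, K_i⁻¹` with `1 ≤ i ≤ b`. -/
def subGens (b : ℕ) : Set G.U :=
  {y | ∃ i, 1 ≤ i ∧ i ≤ b ∧ (y = G.e i ∨ y = G.f i ∨ y = G.K i ∨ y = G.Kinv i)}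

/-- the subalgebra `U_q(sl_{b+1}) ⊆ U_q(sl_{d+1})` generated by
`e_i, f_i, q^{±h_i}` for `1 ≤ i ≤ b`. -/
def Usub (b : ℕ) : Subalgebra KK G.U := Algebra.adjoin KK (subGens G b)

/-- the subspace `U_q(sl_{b+1}) • x ⊆ V`. -/
def USpan (b : ℕ) (x : V) : Submodule KK V :=
  Submodule.span KK {w : V | ∃ p ∈ Usub G b, w = p • x}

theorem qv_ne_zero : qv ≠ 0 := RatFunc.X_ne_zero

theorem qv_pow_ne_one {n : ℕ} (hn : n ≠ 0) : qv ^ n ≠ 1 := by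
  intro h
  have h1 : (algebraMap (Polynomial ℚ) (RatFunc ℚ)) (Polynomial.X ^ n)
      = algebraMap (Polynomial ℚ) (RatFunc ℚ) 1 := by
    simpa [qv, RatFunc.algebraMap_X] using h
  have h2 := congrArg Polynomial.natDegree (RatFunc.algebraMap_injective ℚ h1)
  simp [hn] at h2

theorem qv_zpow_eq_one_iff {n : ℤ} : qv ^ n = 1 ↔ n = 0 := by
  refine ⟨fun h => ?_, fun h => by simp [h]⟩
  by_contra hn
  have h0 : n.natAbs ≠ 0 := by omega
  rcases Int.natAbs_eq n with h1 | h1 <;> rw [h1] at h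
  · exact qv_pow_ne_one h0 (by rwa [zpow_natCast] at h)
  · exact qv_pow_ne_one h0 (by rwa [zpow_neg, zpow_natCast, inv_eq_one] at h)

theorem qv_zpow_injective : Function.Injective fun n : ℤ => qv ^ n := by
  intro a b h
  have : qv ^ (a - b) = 1 := by
    rw [zpow_sub₀ qv_ne_zero]
    exact div_eq_one_iff_eq (zpow_ne_zero _ qv_ne_zero) |>.2 h
  have := qv_zpow_eq_one_iff.1 this
  omega

theorem qv_sub_inv_ne_zero : qv - qv⁻¹ ≠ 0 := by
  intro h
  have h1 : (fun n : ℤ => qv ^ n) 1 = (fun n : ℤ => qv ^ n) (-1) := by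
    simpa using sub_eq_zero.1 h
  have := qv_zpow_injective h1
  omega

/-- the quantum integer `[n]_q` for `n : ℤ`. -/
def qIntZ (n : ℤ) : KK := (qv - qv⁻¹)⁻¹ * (qv ^ n - qv ^ (-n))

theorem qIntZ_ne_zero {n : ℤ} (hn : n ≠ 0) : qIntZ n ≠ 0 := by
  refine mul_ne_zero (inv_ne_zero qv_sub_inv_ne_zero) (sub_ne_zero.2 fun h => hn ?_)
  have := qv_zpow_injective h
  omega

theorem qIntZ_zero : qIntZ 0 = 0 := by simp [qIntZ]

theorem qIntZ_mul_add (s n : ℤ) :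
    qIntZ (s + 1) * qIntZ (n - s) + qIntZ (n - 2 * (s + 1)) =
      qIntZ (s + 2) * qIntZ (n - (s + 1)) := by
  have h := qv_ne_zero
  have h1 := qv_sub_inv_ne_zero
  have e2 : qv ^ (2 * (s + 1)) = (qv ^ s) ^ 2 * qv ^ 2 := by
    rw [mul_comm, zpow_mul, zpow_add₀ h]
    norm_cast
    ring
  have e3 : qv ^ (2 : ℤ) = qv ^ 2 := by norm_cast
  simp only [qIntZ, zpow_neg, zpow_add₀ h, zpow_sub₀ h, e2, zpow_one, e3]
  have hs : qv ^ s ≠ 0 := zpow_ne_zero _ h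
  have hn : qv ^ n ≠ 0 := zpow_ne_zero _ h
  generalize qv ^ s = x at *
  generalize qv ^ n = y at *
  have h2 : qv ^ 2 - 1 ≠ 0 := by
    intro h3
    apply h1
    field_simp
    rw [h3, mul_zero]
  have : qv - qv⁻¹ = (qv ^ 2 - 1) / qv := by field_simp
  rw [this]
  field_simp
  ring

theorem qFact_ne_zero (n : ℕ) : qFact n ≠ 0 := by
  induction n with
  | zero => simp [qFact]
  | succ n ih =>
    refine mul_ne_zero ih ?_
    have : qInt (n + 1) = qIntZ ((n + 1 : ℕ) : ℤ) := by
      simp only [qInt, qIntZ, zpow_neg, zpow_natCast, inv_pow]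
      ring
    rw [this]
    exact qIntZ_ne_zero (by omega)

open Classical in
/-- `ℚ(q)` is formally real. -/
theorem eq_zero_of_sum_mul_self_eq_zero {ι : Type} [Fintype ι] (t : ι → KK)
    (h : ∑ i, t i * t i = 0) (i : ι) : t i = 0 := by
  obtain ⟨b, hb⟩ := IsLocalization.exist_integer_multiples_of_finset
    (nonZeroDivisors (Polynomial ℚ)) (Finset.univ.image t)
  have hb0 : algebraMap (Polynomial ℚ) (RatFunc ℚ) b ≠ 0 :=
    (map_ne_zero_iff _ (RatFunc.algebraMap_injective ℚ)).2 (nonZeroDivisors.ne_zero b.2)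
  choose p hp using fun i => hb (t i) (Finset.mem_image_of_mem _ (Finset.mem_univ i))
  have hsum : ∑ i, p i * p i = 0 := by
    apply RatFunc.algebraMap_injective ℚ
    simp only [map_sum, map_mul, map_zero, hp, Algebra.smul_def]
    rw [← mul_zero (algebraMap (Polynomial ℚ) (RatFunc ℚ) b * algebraMap _ _ (b : Polynomial ℚ)),
      ← h, Finset.mul_sum]
    exact Finset.sum_congr rfl fun i _ => by ring
  have hpi : p i = 0 := by
    refine Polynomial.funext fun x => ?_
    have h1 := congrArg (Polynomial.eval x) hsum
    simp only [Polynomial.eval_finsetSum, Polynomial.eval_mul, Polynomial.eval_zero] at h1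
    have := (Finset.sum_eq_zero_iff_of_nonneg fun i _ => mul_self_nonneg _).1 h1 i
      (Finset.mem_univ i)
    simpa using this
  have h2 := hp i
  rw [hpi, map_zero, Algebra.smul_def] at h2
  exact (mul_eq_zero.1 h2.symm).resolve_left hb0

/-- Operators `e i, f i, K i, Kinv i` (`1 ≤ i ≤ b`) satisfying all defining relations of the
quantum group except possibly the Serre relations. -/
structure IsQRep {Z : Type} [AddCommGroup Z] [Module KK Z] (b : ℕ)
    (e f K Kinv : ℕ → Module.End KK Z) : Prop where
  K_Kinv : ∀ i, 1 ≤ i → i ≤ b → ∀ z, K i (Kinv i z) = z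
  Kinv_K : ∀ i, 1 ≤ i → i ≤ b → ∀ z, Kinv i (K i z) = z
  K_comm : ∀ i j, 1 ≤ i → i ≤ b → 1 ≤ j → j ≤ b → ∀ z, K i (K j z) = K j (K i z)
  K_e : ∀ i j, 1 ≤ i → i ≤ b → 1 ≤ j → j ≤ b → ∀ z,
    K i (e j z) = qv ^ cartan i j • e j (K i z)
  K_f : ∀ i j, 1 ≤ i → i ≤ b → 1 ≤ j → j ≤ b → ∀ z,
    K i (f j z) = qv ^ (-cartan i j) • f j (K i z)
  e_f : ∀ i j, 1 ≤ i → i ≤ b → 1 ≤ j → j ≤ b → ∀ z,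
    e i (f j z) - f j (e i z) = if i = j then (qv - qv⁻¹)⁻¹ • (K i z - Kinv i z) else 0

namespace IsQRep

variable {Z : Type} [AddCommGroup Z] [Module KK Z] {b : ℕ} {e f K Kinv : ℕ → Module.End KK Z}

theorem mono (h : IsQRep b e f K Kinv) {c : ℕ} (hc : c ≤ b) : IsQRep c e f K Kinv where
  K_Kinv i h1 h2 := h.K_Kinv i h1 (h2.trans hc)
  Kinv_K i h1 h2 := h.Kinv_K i h1 (h2.trans hc)
  K_comm i j h1 h2 h3 h4 := h.K_comm i j h1 (h2.trans hc) h3 (h4.trans hc)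
  K_e i j h1 h2 h3 h4 := h.K_e i j h1 (h2.trans hc) h3 (h4.trans hc)
  K_f i j h1 h2 h3 h4 := h.K_f i j h1 (h2.trans hc) h3 (h4.trans hc)
  e_f i j h1 h2 h3 h4 := h.e_f i j h1 (h2.trans hc) h3 (h4.trans hc)

theorem prod {Y : Type} [AddCommGroup Y] [Module KK Y] {e' f' K' Kinv' : ℕ → Module.End KK Y}
    (h : IsQRep b e f K Kinv) (h' : IsQRep b e' f' K' Kinv') :
    IsQRep b (fun i => (e i).prodMap (e' i)) (fun i => (f i).prodMap (f' i))
      (fun i => (K i).prodMap (K' i)) (fun i => (Kinv i).prodMap (Kinv' i)) where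
  K_Kinv i h1 h2 z := Prod.ext (h.K_Kinv i h1 h2 _) (h'.K_Kinv i h1 h2 _)
  Kinv_K i h1 h2 z := Prod.ext (h.Kinv_K i h1 h2 _) (h'.Kinv_K i h1 h2 _)
  K_comm i j h1 h2 h3 h4 z := Prod.ext (h.K_comm i j h1 h2 h3 h4 _) (h'.K_comm i j h1 h2 h3 h4 _)
  K_e i j h1 h2 h3 h4 z := Prod.ext (h.K_e i j h1 h2 h3 h4 _) (h'.K_e i j h1 h2 h3 h4 _)
  K_f i j h1 h2 h3 h4 z := Prod.ext (h.K_f i j h1 h2 h3 h4 _) (h'.K_f i j h1 h2 h3 h4 _)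
  e_f i j h1 h2 h3 h4 z := by
    have e1 := h.e_f i j h1 h2 h3 h4 z.1
    have e2 := h'.e_f i j h1 h2 h3 h4 z.2
    split_ifs at e1 e2 ⊢ <;> exact Prod.ext e1 e2

theorem Kinv_eq (h : IsQRep b e f K Kinv) {i : ℕ} (h1 : 1 ≤ i) (h2 : i ≤ b) {z : Z} {n : ℤ}
    (hz : K i z = qv ^ n • z) : Kinv i z = qv ^ (-n) • z := by
  have := congrArg (Kinv i) hz
  rw [h.Kinv_K i h1 h2, map_smul] at this
  conv_rhs => rw [this]
  rw [smul_smul, ← zpow_add₀ qv_ne_zero]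
  simp

theorem e_Kinv (h : IsQRep b e f K Kinv) {i j : ℕ} (h1 : 1 ≤ i) (h2 : i ≤ b) (h3 : 1 ≤ j)
    (h4 : j ≤ b) (z : Z) : e j (Kinv i z) = qv ^ cartan i j • Kinv i (e j z) := by
  have := congrArg (Kinv i) (h.K_e i j h1 h2 h3 h4 (Kinv i z))
  rw [h.Kinv_K i h1 h2, h.K_Kinv i h1 h2, map_smul] at this
  exact this

theorem K_Kinv_comm (h : IsQRep b e f K Kinv) {i j : ℕ} (h1 : 1 ≤ i) (h2 : i ≤ b) (h3 : 1 ≤ j)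
    (h4 : j ≤ b) (z : Z) : K i (Kinv j z) = Kinv j (K i z) := by
  have := congrArg (Kinv j) (h.K_comm i j h1 h2 h3 h4 (Kinv j z))
  rwa [h.Kinv_K j h3 h4, h.K_Kinv j h3 h4, eq_comm] at this

theorem K_f_pow (h : IsQRep b e f K Kinv) {i j : ℕ} (h1 : 1 ≤ i) (h2 : i ≤ b) (h3 : 1 ≤ j)
    (h4 : j ≤ b) {z : Z} {n : ℤ} (hz : K i z = qv ^ n • z) (s : ℕ) :
    K i ((f j ^ s) z) = qv ^ (n - s * cartan i j) • (f j ^ s) z := by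
  induction s with
  | zero => simpa using hz
  | succ s ih =>
    rw [pow_succ', Module.End.mul_apply, h.K_f i j h1 h2 h3 h4, ih, map_smul, smul_smul,
      ← zpow_add₀ qv_ne_zero]
    congr 2
    push_cast
    ring

theorem e_f_pow_of_ne (h : IsQRep b e f K Kinv) {i j : ℕ} (h1 : 1 ≤ i) (h2 : i ≤ b) (h3 : 1 ≤ j)
    (h4 : j ≤ b) (hij : i ≠ j) (z : Z) (s : ℕ) : e i ((f j ^ s) z) = (f j ^ s) (e i z) := by
  induction s with
  | zero => simp
  | succ s ih =>
    have := h.e_f i j h1 h2 h3 h4 ((f j ^ s) z)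
    rw [if_neg hij, sub_eq_zero] at this
    rw [pow_succ', Module.End.mul_apply, this, ih, Module.End.mul_apply]

theorem e_f_pow (h : IsQRep b e f K Kinv) {i : ℕ} (h1 : 1 ≤ i) (h2 : i ≤ b) {z : Z} {n : ℤ}
    (hz : K i z = qv ^ n • z) (he : e i z = 0) (s : ℕ) :
    e i ((f i ^ (s + 1)) z) = (qIntZ (s + 1) * qIntZ (n - s)) • (f i ^ s) z := by
  have key : ∀ s : ℕ, e i (f i ((f i ^ s) z)) =
      f i (e i ((f i ^ s) z)) + qIntZ (n - 2 * s) • (f i ^ s) z := by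
    intro s
    have e1 := h.e_f i i h1 h2 h1 h2 ((f i ^ s) z)
    have e2 := h.K_f_pow h1 h2 h1 h2 hz s
    rw [if_pos rfl, h.Kinv_eq h1 h2 e2, e2, ← sub_smul, smul_smul, sub_eq_iff_eq_add'] at e1
    rw [e1]
    congr 3
    simp [cartan, mul_comm]
  induction s with
  | zero =>
    have := key 0
    simp only [pow_zero, Module.End.one_apply, he, map_zero, zero_add] at this
    rw [pow_succ', Module.End.mul_apply, pow_zero, Module.End.one_apply, this]
    have h1 : qIntZ 1 = 1 := by
      simp only [qIntZ, zpow_neg, zpow_one]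
      exact inv_mul_cancel₀ qv_sub_inv_ne_zero
    simp [h1]
  | succ s ih =>
    rw [pow_succ', Module.End.mul_apply, key, ih, map_smul, ← Module.End.mul_apply, ← pow_succ',
      ← add_smul]
    have := qIntZ_mul_add s n
    push_cast
    rw [this]
    congr 3

theorem f_pow_ne_zero (h : IsQRep b e f K Kinv) {i : ℕ} (h1 : 1 ≤ i) (h2 : i ≤ b) {z : Z} {n : ℤ}
    (hz : K i z = qv ^ n • z) (he : e i z = 0) (h0 : z ≠ 0) (s : ℕ)
    (hs : ∀ t : ℕ, t < s → n ≠ t) : (f i ^ s) z ≠ 0 := by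
  induction s with
  | zero => simpa using h0
  | succ s ih =>
    intro hc
    have h3 := h.e_f_pow h1 h2 hz he s
    rw [hc, map_zero] at h3
    have h4 := hs s (by omega)
    refine smul_ne_zero (mul_ne_zero (qIntZ_ne_zero ?_) (qIntZ_ne_zero ?_))
      (ih fun t ht => hs t (by omega)) h3.symm <;> omega

theorem f_pow_eq_zero [FiniteDimensional KK Z] (h : IsQRep b e f K Kinv) {i : ℕ} (h1 : 1 ≤ i)
    (h2 : i ≤ b) {z : Z} {n : ℕ} (hz : K i z = qv ^ (n : ℤ) • z) (he : e i z = 0) :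
    (f i ^ (n + 1)) z = 0 := by
  by_contra h0
  have e1 : e i ((f i ^ (n + 1)) z) = 0 := by
    rw [h.e_f_pow h1 h2 hz he]
    simp [qIntZ_zero]
  have e2 := h.K_f_pow h1 h2 h1 h2 hz (n + 1)
  set y := (f i ^ (n + 1)) z
  have hinj : Function.Injective fun s : ℕ =>
      qv ^ ((n : ℤ) - (n + 1 : ℕ) * cartan i i - s * cartan i i) := by
    intro s t hst
    have := qv_zpow_injective hst
    simp only [cartan, if_true] at this
    omega
  have hev : ∀ s : ℕ, (K i).HasEigenvalue
      (qv ^ ((n : ℤ) - (n + 1 : ℕ) * cartan i i - s * cartan i i)) := fun s =>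
    Module.End.hasEigenvalue_of_hasEigenvector (x := (f i ^ s) y)
      ⟨Module.End.mem_eigenspace_iff.2 (h.K_f_pow h1 h2 h1 h2 e2 s),
        h.f_pow_ne_zero h1 h2 e2 e1 h0 s fun t _ => by simp only [cartan, if_true]; push_cast; omega⟩
  exact Set.infinite_of_injective_forall_mem hinj hev (Module.End.finite_hasEigenvalue (K i))

end IsQRep

/-- the span of the vectors `f_{i₁} ⋯ f_{iᵣ} z` with `1 ≤ i₁, …, iᵣ ≤ b`. -/
def fSpan {Z : Type} [AddCommGroup Z] [Module KK Z] (b : ℕ) (f : ℕ → Module.End KK Z) (z : Z) :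
    Submodule KK Z :=
  Submodule.span KK {y | ∃ l : List ℕ, (∀ i ∈ l, 1 ≤ i ∧ i ≤ b) ∧ y = (l.map f).prod z}

/-- the span of the vectors `f_{i₁} ⋯ f_{iᵣ} z` with `r ≥ 1` and `1 ≤ i₁, …, iᵣ ≤ b`. -/
def fSpanPos {Z : Type} [AddCommGroup Z] [Module KK Z] (b : ℕ) (f : ℕ → Module.End KK Z) (z : Z) :
    Submodule KK Z :=
  Submodule.span KK {y | ∃ l : List ℕ, l ≠ [] ∧ (∀ i ∈ l, 1 ≤ i ∧ i ≤ b) ∧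
    y = (l.map f).prod z}

section fSpan

variable {Z : Type} [AddCommGroup Z] [Module KK Z] {b : ℕ} {e f K Kinv : ℕ → Module.End KK Z}
  {z : Z} {lam : ℕ → ℤ}

theorem self_mem_fSpan : z ∈ fSpan b f z := Submodule.subset_span ⟨[], by simp, by simp⟩

theorem f_mem_fSpan {i : ℕ} (h1 : 1 ≤ i) (h2 : i ≤ b) {y : Z} (hy : y ∈ fSpan b f z) :
    f i y ∈ fSpan b f z := by
  suffices fSpan b f z ≤ (fSpan b f z).comap (f i) from this hy
  refine Submodule.span_le.2 ?_
  rintro _ ⟨l, hl, rfl⟩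
  exact Submodule.subset_span ⟨i :: l, by simpa using ⟨⟨h1, h2⟩, hl⟩, by simp⟩

theorem fSpan_le {W : Submodule KK Z} (hz : z ∈ W)
    (hW : ∀ i, 1 ≤ i → i ≤ b → ∀ y ∈ W, f i y ∈ W) : fSpan b f z ≤ W := by
  refine Submodule.span_le.2 ?_
  rintro _ ⟨l, hl, rfl⟩
  induction l with
  | nil => simpa using hz
  | cons i l ih =>
    have hi := hl i (by simp)
    simpa using hW i hi.1 hi.2 _ (ih fun j hj => hl j (by simp [hj]))

theorem fSpanPos_le {W : Submodule KK Z}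
    (hW : ∀ i, 1 ≤ i → i ≤ b → ∀ y ∈ fSpan b f z, f i y ∈ W) : fSpanPos b f z ≤ W := by
  refine Submodule.span_le.2 ?_
  rintro _ ⟨l, hn, hl, rfl⟩
  obtain ⟨i, l, rfl⟩ := List.exists_cons_of_ne_nil hn
  have hi := hl i (by simp)
  simpa using hW i hi.1 hi.2 _
    (Submodule.subset_span ⟨l, fun j hj => hl j (by simp [hj]), rfl⟩)

theorem exists_smul_add_of_mem_fSpan {x : Z} (hx : x ∈ fSpan b f z) :
    ∃ c : KK, ∃ y ∈ fSpanPos b f z, x = c • z + y := by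
  have : fSpan b f z ≤ Submodule.span KK {z} ⊔ fSpanPos b f z := by
    refine Submodule.span_le.2 ?_
    rintro _ ⟨l, hl, rfl⟩
    rcases eq_or_ne l [] with rfl | hn
    · exact Submodule.mem_sup_left (by simp [Submodule.mem_span_singleton_self])
    · exact Submodule.mem_sup_right (Submodule.subset_span ⟨l, hn, hl, rfl⟩)
  obtain ⟨y, hy, y', hy', rfl⟩ := Submodule.mem_sup.1 (this hx)
  obtain ⟨c, rfl⟩ := Submodule.mem_span_singleton.1 hy
  exact ⟨c, y', hy', rfl⟩

theorem IsQRep.K_word (h : IsQRep b e f K Kinv)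
    (hz : ∀ i, 1 ≤ i → i ≤ b → K i z = qv ^ lam i • z) {i : ℕ} (h1 : 1 ≤ i) (h2 : i ≤ b)
    (l : List ℕ) (hl : ∀ i ∈ l, 1 ≤ i ∧ i ≤ b) :
    K i ((l.map f).prod z) = qv ^ (lam i - (l.map (cartan i)).sum) • (l.map f).prod z := by
  induction l with
  | nil => simpa using hz i h1 h2
  | cons j l ih =>
    have hj := hl j (by simp)
    simp only [List.map_cons, List.prod_cons, List.sum_cons, Module.End.mul_apply]
    rw [h.K_f i j h1 h2 hj.1 hj.2, ih fun j hj => hl j (by simp [hj]), map_smul, smul_smul,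
      ← zpow_add₀ qv_ne_zero]
    congr 2
    ring

theorem IsQRep.K_mem_fSpan (h : IsQRep b e f K Kinv)
    (hz : ∀ i, 1 ≤ i → i ≤ b → K i z = qv ^ lam i • z) {i : ℕ} (h1 : 1 ≤ i) (h2 : i ≤ b)
    {y : Z} (hy : y ∈ fSpan b f z) : K i y ∈ fSpan b f z := by
  suffices fSpan b f z ≤ (fSpan b f z).comap (K i) from this hy
  refine Submodule.span_le.2 ?_
  rintro _ ⟨l, hl, rfl⟩
  show K i _ ∈ fSpan b f z
  rw [h.K_word hz h1 h2 l hl]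
  exact Submodule.smul_mem _ _ (Submodule.subset_span ⟨l, hl, rfl⟩)

theorem IsQRep.Kinv_mem_fSpan (h : IsQRep b e f K Kinv)
    (hz : ∀ i, 1 ≤ i → i ≤ b → K i z = qv ^ lam i • z) {i : ℕ} (h1 : 1 ≤ i) (h2 : i ≤ b)
    {y : Z} (hy : y ∈ fSpan b f z) : Kinv i y ∈ fSpan b f z := by
  suffices fSpan b f z ≤ (fSpan b f z).comap (Kinv i) from this hy
  refine Submodule.span_le.2 ?_
  rintro _ ⟨l, hl, rfl⟩
  show Kinv i _ ∈ fSpan b f z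
  rw [h.Kinv_eq h1 h2 (h.K_word hz h1 h2 l hl)]
  exact Submodule.smul_mem _ _ (Submodule.subset_span ⟨l, hl, rfl⟩)

theorem IsQRep.e_mem_fSpan (h : IsQRep b e f K Kinv)
    (hz : ∀ i, 1 ≤ i → i ≤ b → K i z = qv ^ lam i • z)
    (he : ∀ i, 1 ≤ i → i ≤ b → e i z = 0) {i : ℕ} (h1 : 1 ≤ i) (h2 : i ≤ b)
    {y : Z} (hy : y ∈ fSpan b f z) : e i y ∈ fSpan b f z := by
  suffices fSpan b f z ≤ (fSpan b f z).comap (e i) from this hy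
  refine Submodule.span_le.2 ?_
  rintro _ ⟨l, hl, rfl⟩
  show e i _ ∈ fSpan b f z
  induction l with
  | nil => simp [he i h1 h2]
  | cons j l ih =>
    have hj := hl j (by simp)
    have hl' : ∀ i ∈ l, 1 ≤ i ∧ i ≤ b := fun j hj => hl j (by simp [hj])
    have hy : (l.map f).prod z ∈ fSpan b f z := Submodule.subset_span ⟨l, hl', rfl⟩
    simp only [List.map_cons, List.prod_cons, Module.End.mul_apply]
    rw [sub_eq_iff_eq_add.1 (h.e_f i j h1 h2 hj.1 hj.2 _)]
    refine add_mem ?_ (f_mem_fSpan hj.1 hj.2 (ih hl'))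
    split_ifs
    · exact Submodule.smul_mem _ _
        (sub_mem (h.K_mem_fSpan hz h1 h2 hy) (h.Kinv_mem_fSpan hz h1 h2 hy))
    · exact zero_mem _

end fSpan

/-- The product `K_1^{c_0} ⋯ K_r^{c_{r-1}}`. -/
def hOp {Z : Type} [AddCommGroup Z] [Module KK Z] (K : ℕ → Module.End KK Z) (c : ℕ → ℕ) :
    ℕ → Module.End KK Z
  | 0 => 1
  | r + 1 => K (r + 1) ^ c r * hOp K c r

section height

variable {Z : Type} [AddCommGroup Z] [Module KK Z] {b : ℕ} {e f K Kinv : ℕ → Module.End KK Z}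
  {z : Z} {lam : ℕ → ℤ}

theorem hOp_apply {μ : ℕ → ℤ} (c : ℕ → ℕ) (hz : ∀ i, 1 ≤ i → i ≤ b → K i z = qv ^ μ i • z) (r : ℕ)
    (hr : r ≤ b) : hOp K c r z = qv ^ (∑ i ∈ Finset.range r, (c i : ℤ) * μ (i + 1)) • z := by
  induction r with
  | zero => simp [hOp]
  | succ r ih =>
    have : ∀ n : ℕ, (K (r + 1) ^ n) z = qv ^ (n * μ (r + 1)) • z := by
      intro n
      induction n with
      | zero => simp
      | succ n ihn =>
        rw [pow_succ', Module.End.mul_apply, ihn, map_smul, hz _ (by omega) hr, smul_smul,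
          ← zpow_add₀ qv_ne_zero]
        congr 2
        push_cast
        ring
    rw [hOp, Module.End.mul_apply, ih (by omega), map_smul, this, smul_smul,
      ← zpow_add₀ qv_ne_zero, Finset.sum_range_succ]

theorem sum_mul_cartan {d j : ℕ} (h1 : 1 ≤ j) (h2 : j ≤ d) :
    ∑ i ∈ Finset.range d, (((i + 1) * (d - i) : ℕ) : ℤ) * cartan (i + 1) j = 2 := by
  obtain ⟨j, rfl⟩ : ∃ j', j = j' + 1 := ⟨j - 1, by omega⟩
  have key : ∀ i ∈ Finset.range d, (((i + 1) * (d - i) : ℕ) : ℤ) * cartan (i + 1) (j + 1) =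
      (if i = j then 2 * ((i + 1) * (d - i) : ℤ) else 0) -
      (if i = j + 1 then ((i + 1) * (d - i) : ℤ) else 0) -
      (if i + 1 = j then ((i + 1) * (d - i) : ℤ) else 0) := by
    intro i hi
    have hi := Finset.mem_range.1 hi
    push_cast [Nat.cast_sub hi.le]
    unfold cartan
    split_ifs <;> omega
  rw [Finset.sum_congr rfl key, Finset.sum_sub_distrib, Finset.sum_sub_distrib]
  have e1 : ∑ i ∈ Finset.range d, (if i = j then 2 * ((i + 1) * (d - i) : ℤ) else 0) =
      2 * ((j + 1) * (d - j)) := by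
    rw [Finset.sum_ite_eq' (Finset.range d) j, if_pos (Finset.mem_range.2 (by omega))]
  have e2 : ∑ i ∈ Finset.range d, (if i = j + 1 then ((i + 1) * (d - i) : ℤ) else 0) =
      (j + 2) * (d - j - 1) := by
    rw [Finset.sum_ite_eq' (Finset.range d) (j + 1)]
    split_ifs with h
    · push_cast; ring
    · have : d = j + 1 := by rw [Finset.mem_range] at h; omega
      subst this; push_cast; ring
  have e3 : ∑ i ∈ Finset.range d, (if i + 1 = j then ((i + 1) * (d - i) : ℤ) else 0) =
      j * (d - j + 1) := by
    rcases j with _ | j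
    · simp
    · simp only [Nat.add_right_cancel_iff]
      rw [Finset.sum_ite_eq' (Finset.range d) j, if_pos (Finset.mem_range.2 (by omega))]
      push_cast; ring
  rw [e1, e2, e3]
  ring

theorem IsQRep.not_mem_fSpanPos (h : IsQRep b e f K Kinv)
    (hz : ∀ i, 1 ≤ i → i ≤ b → K i z = qv ^ lam i • z) (h0 : z ≠ 0) : z ∉ fSpanPos b f z := by
  intro hmem
  set H := hOp K (fun i => (i + 1) * (b - i)) b with hH
  set N : ℤ := ∑ i ∈ Finset.range b, (((i + 1) * (b - i) : ℕ) : ℤ) * lam (i + 1) with hN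
  have hHz : H z = qv ^ N • z := hOp_apply _ hz b le_rfl
  have hle : fSpanPos b f z ≤ ⨆ ν ≠ qv ^ N, H.eigenspace ν := by
    refine Submodule.span_le.2 ?_
    rintro _ ⟨l, hn, hl, rfl⟩
    have e1 : ∑ i ∈ Finset.range b, (((i + 1) * (b - i) : ℕ) : ℤ) *
        (lam (i + 1) - (l.map (cartan (i + 1))).sum) = N - 2 * l.length := by
      simp only [mul_sub, Finset.sum_sub_distrib, ← hN]
      congr 1
      clear hn hmem
      induction l with
      | nil => simp
      | cons j l ih =>
        have hj := hl j (by simp)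
        simp only [List.map_cons, List.sum_cons, mul_add, Finset.sum_add_distrib,
          ih fun j hj => hl j (by simp [hj]), sum_mul_cartan hj.1 hj.2, List.length_cons]
        push_cast
        ring
    have e2 := hOp_apply (K := K) (z := (l.map f).prod z)
      (μ := fun i => lam i - (l.map (cartan i)).sum) (fun i => (i + 1) * (b - i))
      (fun i h1 h2 => h.K_word hz h1 h2 l hl) b le_rfl
    rw [e1] at e2
    refine Submodule.mem_iSup_of_mem (qv ^ (N - 2 * l.length)) (Submodule.mem_iSup_of_mem ?_
      (Module.End.mem_eigenspace_iff.2 e2))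
    intro hc
    have h3 := qv_zpow_injective hc
    have := List.length_pos_of_ne_nil hn
    omega
  have hd := (Module.End.eigenspaces_iSupIndep H) (qv ^ N)
  exact h0 (Submodule.disjoint_def.1 hd z (Module.End.mem_eigenspace_iff.2 hHz) (hle hmem))

end height

/-- A representation in the sense of `IsQRep` with a contravariant form `B` none of whose nonempty
sums of values `B t t` with `t ≠ 0` vanishes, and a primitive vector `w` of weight `lam`. -/
structure IsUnitary {T : Type} [AddCommGroup T] [Module KK T] (b : ℕ)
    (e f K Kinv : ℕ → Module.End KK T) (B : LinearMap.BilinForm KK T) (lam : ℕ → ℤ) (w : T) :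
    Prop where
  rep : IsQRep b e f K Kinv
  symm : ∀ x y, B x y = B y x
  aniso : ∀ (ι : Type) [Fintype ι] (t : ι → T), ∑ i, B (t i) (t i) = 0 → ∀ i, t i = 0
  K_symm : ∀ i, 1 ≤ i → i ≤ b → ∀ x y, B (K i x) y = B x (K i y)
  e_adj : ∀ i, 1 ≤ i → i ≤ b → ∀ x y, B (e i x) y = qv⁻¹ * B x (f i (K i y))
  ne_zero : w ≠ 0
  e_w : ∀ i, 1 ≤ i → i ≤ b → e i w = 0
  K_w : ∀ i, 1 ≤ i → i ≤ b → K i w = qv ^ lam i • w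

namespace IsUnitary

variable {T : Type} [AddCommGroup T] [Module KK T] {b : ℕ} {e f K Kinv : ℕ → Module.End KK T}
  {B : LinearMap.BilinForm KK T} {lam : ℕ → ℤ} {w : T}

theorem self_eq_zero (h : IsUnitary b e f K Kinv B lam w) {x : T} (hx : B x x = 0) : x = 0 :=
  h.aniso Unit (fun _ => x) (by simpa using hx) ()

theorem f_adj (h : IsUnitary b e f K Kinv B lam w) {i : ℕ} (h1 : 1 ≤ i) (h2 : i ≤ b) (x y : T) :
    B (f i x) y = qv * B (Kinv i x) (e i y) := by
  have := h.e_adj i h1 h2 y (Kinv i x)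
  rw [h.rep.K_Kinv i h1 h2] at this
  rw [h.symm (Kinv i x), this, h.symm y, mul_inv_cancel_left₀ qv_ne_zero]

theorem Kinv_symm (h : IsUnitary b e f K Kinv B lam w) {i : ℕ} (h1 : 1 ≤ i) (h2 : i ≤ b)
    (x y : T) : B (Kinv i x) y = B x (Kinv i y) := by
  have := h.K_symm i h1 h2 (Kinv i x) (Kinv i y)
  rw [h.rep.K_Kinv i h1 h2, h.rep.K_Kinv i h1 h2] at this
  exact this.symm

theorem fSpanPos_orthogonal (h : IsUnitary b e f K Kinv B lam w) {c : ℕ} (hc : c ≤ b) {x y z : T}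
    (hx : ∀ i, 1 ≤ i → i ≤ c → e i x = 0) (hy : y ∈ fSpanPos c f z) : B y x = 0 := by
  suffices fSpanPos c f z ≤ LinearMap.ker (B.flip x) from this hy
  refine fSpanPos_le fun i h1 h2 u _ => ?_
  show B (f i u) x = 0
  rw [h.f_adj h1 (h2.trans hc), hx i h1 h2]
  simp

/-- An irreducible module generated by a primitive vector of weight `lam` embeds into a unitary
module with a primitive vector of the same weight. -/
theorem exists_embedding (h : IsUnitary b e f K Kinv B lam w)
    {V : Type} [AddCommGroup V] [Module KK V] {e' f' K' Kinv' : ℕ → Module.End KK V}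
    (h' : IsQRep b e' f' K' Kinv') {v : V} (hv : v ≠ 0)
    (he' : ∀ i, 1 ≤ i → i ≤ b → e' i v = 0)
    (hK' : ∀ i, 1 ≤ i → i ≤ b → K' i v = qv ^ lam i • v)
    (irr : ∀ W : Submodule KK V, (∀ i, 1 ≤ i → i ≤ b → ∀ x ∈ W,
      e' i x ∈ W ∧ f' i x ∈ W ∧ K' i x ∈ W ∧ Kinv' i x ∈ W) → W = ⊥ ∨ W = ⊤) :
    ∃ φ : V →ₗ[KK] T, Function.Injective φ ∧ ∀ i, 1 ≤ i → i ≤ b → ∀ x,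
      φ (e' i x) = e i (φ x) ∧ φ (f' i x) = f i (φ x) ∧ φ (K' i x) = K i (φ x) := by
  have hp := h'.prod h.rep
  set F : ℕ → Module.End KK (V × T) := fun i => (f' i).prodMap (f i) with hF
  have hKp : ∀ i, 1 ≤ i → i ≤ b → (K' i).prodMap (K i) (v, w) = qv ^ lam i • (v, w) :=
    fun i h1 h2 => Prod.ext (hK' i h1 h2) (h.K_w i h1 h2)
  have hep : ∀ i, 1 ≤ i → i ≤ b → (e' i).prodMap (e i) (v, w) = 0 :=
    fun i h1 h2 => Prod.ext (he' i h1 h2) (h.e_w i h1 h2)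
  set D := fSpan b F (v, w) with hD
  have De : ∀ i, 1 ≤ i → i ≤ b → ∀ x ∈ D, (e' i x.1, e i x.2) ∈ D :=
    fun i h1 h2 x hx => hp.e_mem_fSpan hKp hep h1 h2 hx
  have Df : ∀ i, 1 ≤ i → i ≤ b → ∀ x ∈ D, (f' i x.1, f i x.2) ∈ D :=
    fun i h1 h2 x hx => f_mem_fSpan (f := F) h1 h2 hx
  have DK : ∀ i, 1 ≤ i → i ≤ b → ∀ x ∈ D, (K' i x.1, K i x.2) ∈ D :=
    fun i h1 h2 x hx => hp.K_mem_fSpan hKp h1 h2 hx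
  have DKi : ∀ i, 1 ≤ i → i ≤ b → ∀ x ∈ D, (Kinv' i x.1, Kinv i x.2) ∈ D :=
    fun i h1 h2 x hx => hp.Kinv_mem_fSpan hKp h1 h2 hx
  have hsnd : D ≤ (fSpan b f w).comap (LinearMap.snd KK V T) :=
    fSpan_le self_mem_fSpan fun i h1 h2 y hy => f_mem_fSpan (f := f) h1 h2 hy
  have hpos : fSpanPos b F (v, w) ≤ (fSpanPos b f' v).prod (fSpanPos b f w) := by
    refine Submodule.span_le.2 ?_
    rintro _ ⟨l, hn, hl, rfl⟩
    have : (l.map F).prod (v, w) = ((l.map f').prod v, (l.map f).prod w) := by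
      clear hn hl
      induction l with
      | nil => simp
      | cons i l ih => rw [List.map_cons, List.prod_cons, Module.End.mul_apply, ih]; rfl
    rw [this]
    exact ⟨Submodule.subset_span ⟨l, hn, hl, rfl⟩, Submodule.subset_span ⟨l, hn, hl, rfl⟩⟩
  have hww : B w w ≠ 0 := fun hc => h.ne_zero (h.self_eq_zero hc)
  have hvpos := h'.not_mem_fSpanPos hK' hv
  have hworth : ∀ y ∈ fSpanPos b f w, B y w = 0 :=
    fun y hy => h.fSpanPos_orthogonal le_rfl h.e_w hy
  have hN' : ∀ t, (0, t) ∈ D → t = 0 := by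
    have h1 : ∀ t, (0, t) ∈ D → B w t = 0 := by
      intro t ht
      obtain ⟨c, y, hy, hxy⟩ := exists_smul_add_of_mem_fSpan ht
      have hy := hpos hy
      have e1 : 0 = c • v + y.1 := congrArg Prod.fst hxy
      have e2 : t = c • w + y.2 := congrArg Prod.snd hxy
      have hc : c = 0 := by
        by_contra hc
        refine hvpos ?_
        have h2 : c⁻¹ • -y.1 = v := by
          rw [neg_eq_of_add_eq_zero_left e1.symm, inv_smul_smul₀ hc]
        have h3 := (fSpanPos b f' v).smul_mem c⁻¹
          ((fSpanPos b f' v).neg_mem (show y.1 ∈ fSpanPos b f' v from hy.1))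
        rwa [h2] at h3
      rw [h.symm, e2, hc, zero_smul, zero_add, hworth _ hy.2]
    intro t ht
    refine h.self_eq_zero ?_
    have h2 : fSpan b f w ≤ (⨅ t : {t // (0, t) ∈ D}, LinearMap.ker (B.flip t.1)) := by
      refine fSpan_le ?_ ?_
      · simp only [Submodule.mem_iInf]
        exact fun t => h1 t.1 t.2
      · intro i hi1 hi2 y hy
        simp only [Submodule.mem_iInf] at hy ⊢
        intro t
        show B (f i y) t.1 = 0
        rw [h.f_adj hi1 hi2, h.Kinv_symm hi1 hi2]
        have h3 := De i hi1 hi2 _ t.2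
        have h4 := DKi i hi1 hi2 _ h3
        simp only [map_zero] at h4
        have : B y (Kinv i (e i t.1)) = 0 := hy ⟨_, h4⟩
        rw [this, mul_zero]
    have h3 := h2 (hsnd ht)
    simp only [Submodule.mem_iInf] at h3
    exact h3 ⟨t, ht⟩
  have hN : ∀ x, (x, 0) ∈ D → x = 0 := by
    have := irr (D.comap (LinearMap.inl KK V T)) ?_
    · rcases this with h1 | h1
      · intro x hx
        have : x ∈ D.comap (LinearMap.inl KK V T) := hx
        rwa [h1, Submodule.mem_bot] at this
      · exfalso
        have : v ∈ D.comap (LinearMap.inl KK V T) := h1 ▸ Submodule.mem_top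
        have h2 : (v, (0 : T)) ∈ D := this
        have h3 := sub_mem (self_mem_fSpan (b := b) (f := F) (z := (v, w))) h2
        rw [Prod.mk_sub_mk, sub_self, sub_zero] at h3
        exact h.ne_zero (hN' _ h3)
    · intro i h1 h2 x hx
      have hx : (x, (0 : T)) ∈ D := hx
      have a1 := De i h1 h2 _ hx
      have a2 := Df i h1 h2 _ hx
      have a3 := DK i h1 h2 _ hx
      have a4 := DKi i h1 h2 _ hx
      simp only [map_zero] at a1 a2 a3 a4
      exact ⟨a1, a2, a3, a4⟩
  have htop : D.map (LinearMap.fst KK V T) = ⊤ := by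
    refine (irr _ ?_).resolve_left ?_
    · rintro i h1 h2 _ ⟨x, hx, rfl⟩
      exact ⟨⟨_, De i h1 h2 x hx, rfl⟩, ⟨_, Df i h1 h2 x hx, rfl⟩, ⟨_, DK i h1 h2 x hx, rfl⟩,
        ⟨_, DKi i h1 h2 x hx, rfl⟩⟩
    · intro hc
      have : v ∈ D.map (LinearMap.fst KK V T) := ⟨_, self_mem_fSpan, rfl⟩
      rw [hc, Submodule.mem_bot] at this
      exact hv this
  let E : D ≃ₗ[KK] V := LinearEquiv.ofBijective ((LinearMap.fst KK V T).domRestrict D) <| by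
    constructor
    · refine (injective_iff_map_eq_zero _).2 ?_
      rintro ⟨⟨x, t⟩, hx⟩ h0
      have h0 : x = 0 := h0
      subst h0
      exact Subtype.ext (Prod.ext rfl (hN' t hx))
    · intro x
      have : x ∈ D.map (LinearMap.fst KK V T) := htop ▸ Submodule.mem_top
      obtain ⟨y, hy, rfl⟩ := this
      exact ⟨⟨y, hy⟩, rfl⟩
  let φ : V →ₗ[KK] T := ((LinearMap.snd KK V T).domRestrict D).comp E.symm.toLinearMap
  have hφ : ∀ x, (x, φ x) ∈ D := by
    intro x
    have h1 : (E.symm x).1.1 = x := E.apply_symm_apply x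
    have h2 : (x, φ x) = (E.symm x).1 := Prod.ext h1.symm rfl
    rw [h2]
    exact (E.symm x).2
  have huniq : ∀ x t, (x, t) ∈ D → φ x = t := by
    intro x t hx
    have h3 := sub_mem (hφ x) hx
    rw [Prod.mk_sub_mk, sub_self] at h3
    exact sub_eq_zero.1 (hN' _ h3)
  refine ⟨φ, (injective_iff_map_eq_zero _).2 fun x hx => hN x ?_, fun i h1 h2 x =>
    ⟨huniq _ _ (De i h1 h2 _ (hφ x)), huniq _ _ (Df i h1 h2 _ (hφ x)),
      huniq _ _ (DK i h1 h2 _ (hφ x))⟩⟩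
  have := hφ x
  rwa [hx] at this

end IsUnitary

section tensor

variable {d : ℕ}

/-- Occupation patterns of `d + 2` sites, standing for the weight vectors of the exterior algebra
of the vector representation (only the sites `1, …, d + 1` matter). -/
abbrev Cfg (d : ℕ) : Type := Fin (d + 2) → Bool

/-- the occupation of site `i`. -/
def Cfg.at (S : Cfg d) (i : ℕ) : Bool := S (Fin.ofNat (d + 2) i)

/-- exchange the sites `i` and `i + 1`. -/
def Cfg.sw (i : ℕ) (S : Cfg d) : Cfg d :=
  S ∘ Equiv.swap (Fin.ofNat (d + 2) i) (Fin.ofNat (d + 2) (i + 1))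

/-- `h_i` on the pattern `S`. -/
def Cfg.wt (i : ℕ) (S : Cfg d) : ℤ :=
  (if S.at i then 1 else 0) - (if S.at (i + 1) then 1 else 0)

theorem ofNat_inj {i j : ℕ} (hi : i ≤ d + 1) (hj : j ≤ d + 1) :
    Fin.ofNat (d + 2) i = Fin.ofNat (d + 2) j ↔ i = j := by
  simp [Fin.ext_iff, Fin.ofNat, Nat.mod_eq_of_lt (show i < d + 2 by omega),
    Nat.mod_eq_of_lt (show j < d + 2 by omega)]

theorem Cfg.sw_sw (i : ℕ) (S : Cfg d) : (S.sw i).sw i = S := by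
  funext t
  simp [Cfg.sw]

theorem Cfg.sw_at {i l : ℕ} (hi : i ≤ d) (hl : l ≤ d + 1) (S : Cfg d) :
    (S.sw i).at l = if l = i then S.at (i + 1) else if l = i + 1 then S.at i else S.at l := by
  simp only [Cfg.sw, Cfg.at, Function.comp, Equiv.swap_apply_def, ofNat_inj hl (hi.trans d.le_succ),
    ofNat_inj hl (show i + 1 ≤ d + 1 by omega)]
  split_ifs <;> rfl

theorem Cfg.ext_at {S S' : Cfg d} (h : ∀ l ≤ d + 1, S.at l = S'.at l) : S = S' := by
  funext t
  have := h t (by omega)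
  simpa [Cfg.at] using this

theorem Cfg.wt_sw_of_dn {i j : ℕ} (hi : i ≤ d) (hj : j ≤ d) {S : Cfg d}
    (h1 : S.at (j + 1) = true) (h2 : S.at j = false) :
    (S.sw j).wt i = S.wt i + cartan i j := by
  unfold Cfg.wt cartan
  rw [Cfg.sw_at hj (by omega), Cfg.sw_at hj (by omega)]
  rcases eq_or_ne i j with rfl | hij
  · simp [h1, h2]
  rcases eq_or_ne (i + 1) j with rfl | hij1
  · simp [h1, h2, show i ≠ i + 1 + 1 by omega]
    ring
  rcases eq_or_ne (j + 1) i with rfl | hij2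
  · simp [h1, h2, show j + 1 + 1 ≠ j by omega]
    ring
  · have : i ≠ j + 1 := fun h => hij2 h.symm
    simp [hij, hij1, hij2, this]

theorem Cfg.wt_sw_of_up {i j : ℕ} (hi : i ≤ d) (hj : j ≤ d) {S : Cfg d}
    (h1 : S.at j = true) (h2 : S.at (j + 1) = false) :
    (S.sw j).wt i = S.wt i - cartan i j := by
  have := Cfg.wt_sw_of_dn (S := S.sw j) hi hj (by rw [Cfg.sw_at hj (by omega)]; simp [h1])
    (by rw [Cfg.sw_at hj (by omega)]; simp [h2])
  rw [Cfg.sw_sw] at this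
  omega

/-- `i` is occupied and `i + 1` is not. -/
def Cfg.Up (i : ℕ) (S : Cfg d) : Prop := S.at i = true ∧ S.at (i + 1) = false

/-- `i + 1` is occupied and `i` is not. -/
def Cfg.Dn (i : ℕ) (S : Cfg d) : Prop := S.at (i + 1) = true ∧ S.at i = false

instance (i : ℕ) (S : Cfg d) : Decidable (S.Up i) := inferInstanceAs (Decidable (_ ∧ _))

instance (i : ℕ) (S : Cfg d) : Decidable (S.Dn i) := inferInstanceAs (Decidable (_ ∧ _))

theorem Cfg.dn_sw_self {i : ℕ} (hi : i ≤ d) (S : Cfg d) : (S.sw i).Dn i ↔ S.Up i := by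
  rw [Cfg.Dn, Cfg.Up, Cfg.sw_at hi (by omega), Cfg.sw_at hi (by omega)]
  simp

theorem Cfg.up_sw_self {i : ℕ} (hi : i ≤ d) (S : Cfg d) : (S.sw i).Up i ↔ S.Dn i := by
  rw [← Cfg.dn_sw_self hi, Cfg.sw_sw]

theorem Cfg.up_dn_comm {i j : ℕ} (hi : i ≤ d) (hj : j ≤ d) (hij : i ≠ j) (S : Cfg d) :
    (S.Up i ∧ (S.sw i).Dn j) ↔ (S.Dn j ∧ (S.sw j).Up i) := by
  simp only [Cfg.Up, Cfg.Dn, Cfg.sw_at hi (show j ≤ d + 1 by omega),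
    Cfg.sw_at hi (show j + 1 ≤ d + 1 by omega), Cfg.sw_at hj (show i ≤ d + 1 by omega),
    Cfg.sw_at hj (show i + 1 ≤ d + 1 by omega)]
  rcases eq_or_ne (i + 1) j with rfl | hij1
  · simp; grind
  rcases eq_or_ne (j + 1) i with rfl | hij2
  · simp; grind
  · have a1 : i ≠ j + 1 := fun h => hij2 h.symm
    have a2 : j ≠ i + 1 := fun h => hij1 h.symm
    simp [hij, hij1, hij2, a1, a2, hij.symm]
    grind

theorem Cfg.sw_comm {i j : ℕ} (hi : i ≤ d) (hj : j ≤ d) (hij : i ≠ j) {S : Cfg d}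
    (h1 : S.Up i) (h2 : (S.sw i).Dn j) : (S.sw i).sw j = (S.sw j).sw i := by
  have h3 := (Cfg.up_dn_comm hi hj hij S).1 ⟨h1, h2⟩
  obtain ⟨⟨h3, h4⟩, h5, h6⟩ := h3
  obtain ⟨h7, h8⟩ := h1
  obtain ⟨h9, h10⟩ := h2
  rw [Cfg.sw_at hj (by omega)] at h5 h6
  rw [Cfg.sw_at hi (by omega)] at h9 h10
  refine Cfg.ext_at fun l hl => ?_
  rw [Cfg.sw_at hj hl, Cfg.sw_at hi hl, Cfg.sw_at hi (by omega), Cfg.sw_at hi (by omega),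
    Cfg.sw_at hi hl, Cfg.sw_at hj (by omega), Cfg.sw_at hj (by omega), Cfg.sw_at hj hl]
  grind

variable {T : Type} [AddCommGroup T] [Module KK T]

/-- `e ⊗ 1 + K ⊗ e` on `(Cfg d → KK) ⊗ T = (Cfg d → T)`. -/
def tensorE (e : ℕ → Module.End KK T) (i : ℕ) : Module.End KK (Cfg d → T) where
  toFun φ S := (if S.Up i then φ (S.sw i) else 0) + qv ^ S.wt i • e i (φ S)
  map_add' φ ψ := by
    funext S
    simp only [Pi.add_apply, map_add, smul_add]
    split_ifs <;> abel
  map_smul' c φ := by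
    funext S
    simp only [Pi.smul_apply, map_smul, RingHom.id_apply, smul_add, smul_ite, smul_zero,
      smul_comm c]

/-- `f ⊗ K⁻¹ + 1 ⊗ f` on `(Cfg d → KK) ⊗ T = (Cfg d → T)`. -/
def tensorF (f Kinv : ℕ → Module.End KK T) (i : ℕ) : Module.End KK (Cfg d → T) where
  toFun φ S := (if S.Dn i then Kinv i (φ (S.sw i)) else 0) + f i (φ S)
  map_add' φ ψ := by
    funext S
    simp only [Pi.add_apply, map_add]
    split_ifs <;> abel
  map_smul' c φ := by
    funext S
    simp only [Pi.smul_apply, map_smul, RingHom.id_apply, smul_add, smul_ite, smul_zero]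

/-- `K ⊗ K` on `(Cfg d → KK) ⊗ T = (Cfg d → T)`. -/
def tensorK (K : ℕ → Module.End KK T) (i : ℕ) : Module.End KK (Cfg d → T) where
  toFun φ S := qv ^ S.wt i • K i (φ S)
  map_add' φ ψ := by
    funext S
    simp only [Pi.add_apply, map_add, smul_add]
  map_smul' c φ := by
    funext S
    simp only [Pi.smul_apply, map_smul, RingHom.id_apply, smul_comm c]

/-- `K⁻¹ ⊗ K⁻¹` on `(Cfg d → KK) ⊗ T = (Cfg d → T)`. -/
def tensorKinv (Kinv : ℕ → Module.End KK T) (i : ℕ) : Module.End KK (Cfg d → T) where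
  toFun φ S := qv ^ (-S.wt i) • Kinv i (φ S)
  map_add' φ ψ := by
    funext S
    simp only [Pi.add_apply, map_add, smul_add]
  map_smul' c φ := by
    funext S
    simp only [Pi.smul_apply, map_smul, RingHom.id_apply, smul_comm c]

/-- The form on `Cfg d → T` making the summands orthogonal. -/
def tensorForm (B : LinearMap.BilinForm KK T) : LinearMap.BilinForm KK (Cfg d → T) :=
  ∑ S : Cfg d, B.compl₁₂ (LinearMap.proj S) (LinearMap.proj S)

theorem tensorForm_apply (B : LinearMap.BilinForm KK T) (φ ψ : Cfg d → T) :
    tensorForm B φ ψ = ∑ S, B (φ S) (ψ S) := by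
  simp [tensorForm]

theorem cartan_comm (i j : ℕ) : cartan i j = cartan j i := by
  unfold cartan
  split_ifs <;> omega

theorem Cfg.wt_of_up {i : ℕ} {S : Cfg d} (h : S.Up i) : S.wt i = 1 := by
  simp [Cfg.wt, h.1, h.2]

theorem Cfg.wt_of_dn {i : ℕ} {S : Cfg d} (h : S.Dn i) : S.wt i = -1 := by
  simp [Cfg.wt, h.1, h.2]

theorem Cfg.wt_of_not {i : ℕ} {S : Cfg d} (h : ¬ S.Up i) (h' : ¬ S.Dn i) : S.wt i = 0 := by
  simp only [Cfg.Up, Cfg.Dn] at h h'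
  unfold Cfg.wt
  grind

variable {e f K Kinv : ℕ → Module.End KK T} {B : LinearMap.BilinForm KK T} {lam : ℕ → ℤ} {w : T}

theorem IsQRep.tensor_e_f (h : IsQRep d e f K Kinv) {i j : ℕ} (h1 : 1 ≤ i) (h2 : i ≤ d)
    (h3 : 1 ≤ j) (h4 : j ≤ d) (φ : Cfg d → T) :
    tensorE e i (tensorF f Kinv j φ) - tensorF f Kinv j (tensorE e i φ) =
      if i = j then (qv - qv⁻¹)⁻¹ • (tensorK K i φ - tensorKinv Kinv i φ) else 0 := by
  funext S
  have hcross : (if S.Dn j then qv ^ S.wt i • e i (Kinv j (φ (S.sw j))) else 0) =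
      if S.Dn j then Kinv j (qv ^ (S.sw j).wt i • e i (φ (S.sw j))) else 0 := by
    split_ifs with hd
    · rw [h.e_Kinv h3 h4 h1 h2, map_smul, smul_smul, Cfg.wt_sw_of_dn h2 h4 hd.1 hd.2,
        zpow_add₀ qv_ne_zero, cartan_comm j i]
    · rfl
  have hL : (tensorE e i (tensorF f Kinv j φ) - tensorF f Kinv j (tensorE e i φ)) S =
      ((if S.Up i ∧ (S.sw i).Dn j then Kinv j (φ ((S.sw i).sw j)) else 0) -
        (if S.Dn j ∧ (S.sw j).Up i then Kinv j (φ ((S.sw j).sw i)) else 0)) +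
      qv ^ S.wt i • (e i (f j (φ S)) - f j (e i (φ S))) := by
    have e1 : tensorE e i (tensorF f Kinv j φ) S =
        (if S.Up i ∧ (S.sw i).Dn j then Kinv j (φ ((S.sw i).sw j)) else 0) +
        (if S.Up i then f j (φ (S.sw i)) else 0) +
        (if S.Dn j then qv ^ S.wt i • e i (Kinv j (φ (S.sw j))) else 0) +
        qv ^ S.wt i • e i (f j (φ S)) := by
      by_cases a1 : S.Up i <;> by_cases a2 : (S.sw i).Dn j <;> by_cases a3 : S.Dn j <;>
        simp only [tensorE, tensorF, LinearMap.coe_mk, AddHom.coe_mk, a1, a2, a3, and_self,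
          and_true, and_false, if_true, if_false, map_add, smul_add, zero_add, add_zero,
          add_assoc]
    have e2 : tensorF f Kinv j (tensorE e i φ) S =
        (if S.Dn j ∧ (S.sw j).Up i then Kinv j (φ ((S.sw j).sw i)) else 0) +
        (if S.Dn j then Kinv j (qv ^ (S.sw j).wt i • e i (φ (S.sw j))) else 0) +
        (if S.Up i then f j (φ (S.sw i)) else 0) +
        qv ^ S.wt i • f j (e i (φ S)) := by
      by_cases a1 : S.Up i <;> by_cases a2 : (S.sw j).Up i <;> by_cases a3 : S.Dn j <;>
        simp only [tensorE, tensorF, LinearMap.coe_mk, AddHom.coe_mk, a1, a2, a3, and_self,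
          and_true, and_false, if_true, if_false, map_add, map_smul, zero_add, add_zero,
          add_assoc]
    rw [Pi.sub_apply, e1, e2, hcross, smul_sub]
    abel
  rw [hL, h.e_f i j h1 h2 h3 h4]
  by_cases hij : i = j
  · subst hij
    have hc := qv_sub_inv_ne_zero
    simp only [Cfg.dn_sw_self h2, Cfg.up_sw_self h2, and_self, Cfg.sw_sw, if_true, Pi.smul_apply,
      Pi.sub_apply, tensorK, tensorKinv, LinearMap.coe_mk, AddHom.coe_mk]
    have hone : Kinv i (φ S) = ((qv - qv⁻¹)⁻¹ * (qv - qv⁻¹)) • Kinv i (φ S) := by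
      rw [inv_mul_cancel₀ hc, one_smul]
    by_cases b1 : S.Up i
    · have b2 : ¬ S.Dn i := fun b2 => by simpa [b1.1] using b2.2
      simp only [b1, b2, if_true, if_false, Cfg.wt_of_up b1, zpow_one, zpow_neg, smul_sub,
        smul_smul, sub_zero]
      nth_rewrite 1 [hone]
      rw [mul_sub, sub_smul, mul_comm qv]
      abel
    by_cases b2 : S.Dn i
    · simp only [b1, b2, if_true, if_false, Cfg.wt_of_dn b2, zpow_one, zpow_neg, neg_neg, smul_sub,
        smul_smul, zero_sub]
      nth_rewrite 1 [hone]
      rw [mul_sub, sub_smul, mul_comm qv⁻¹]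
      abel
    · simp [b1, b2, Cfg.wt_of_not b1 b2]
  · have hcomm := Cfg.up_dn_comm h2 h4 hij S
    by_cases b1 : S.Up i ∧ (S.sw i).Dn j
    · simp [hij, b1, hcomm.1 b1, Cfg.sw_comm h2 h4 hij b1.1 b1.2]
    · rw [if_neg hij, if_neg hij, if_neg b1, if_neg (mt hcomm.2 b1)]
      simp

theorem IsQRep.tensor (h : IsQRep d e f K Kinv) :
    IsQRep d (tensorE (d := d) e) (tensorF f Kinv) (tensorK K) (tensorKinv Kinv) where
  K_Kinv i h1 h2 φ := by
    funext S
    simp [tensorK, tensorKinv, h.K_Kinv i h1 h2, zpow_ne_zero _ qv_ne_zero]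
  Kinv_K i h1 h2 φ := by
    funext S
    simp [tensorK, tensorKinv, h.Kinv_K i h1 h2, zpow_ne_zero _ qv_ne_zero]
  K_comm i j h1 h2 h3 h4 φ := by
    funext S
    simp only [tensorK, LinearMap.coe_mk, AddHom.coe_mk, map_smul, h.K_comm i j h1 h2 h3 h4]
    rw [smul_comm]
  K_e i j h1 h2 h3 h4 φ := by
    funext S
    simp only [tensorK, tensorE, LinearMap.coe_mk, AddHom.coe_mk, Pi.smul_apply, map_add,
      map_smul, smul_add, smul_smul, h.K_e i j h1 h2 h3 h4]
    congr 1
    · split_ifs with hu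
      · rw [Cfg.wt_sw_of_up h2 h4 hu.1 hu.2, smul_smul, ← zpow_add₀ qv_ne_zero]
        congr 2
        ring
      · simp
    · congr 1
      ring
  K_f i j h1 h2 h3 h4 φ := by
    funext S
    simp only [tensorK, tensorF, LinearMap.coe_mk, AddHom.coe_mk, Pi.smul_apply, map_add,
      map_smul, smul_add, smul_smul, h.K_f i j h1 h2 h3 h4]
    congr 1
    · split_ifs with hu
      · rw [Cfg.wt_sw_of_dn h2 h4 hu.1 hu.2, smul_smul, ← zpow_add₀ qv_ne_zero,
          h.K_Kinv_comm h1 h2 h3 h4]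
        congr 2
        ring
      · simp
    · congr 1
      ring
  e_f i j h1 h2 h3 h4 φ := h.tensor_e_f h1 h2 h3 h4 φ

theorem IsUnitary.tensor (h : IsUnitary d e f K Kinv B lam w) {a : ℕ} (ha : 1 ≤ a) :
    IsUnitary d (tensorE (d := d) e) (tensorF f Kinv) (tensorK K) (tensorKinv Kinv) (tensorForm B)
      (fun i => omWt a 1 i + lam i)
      (Pi.single (fun t : Fin (d + 2) => decide (1 ≤ t.1 ∧ t.1 ≤ a)) w) where
  rep := h.rep.tensor
  symm φ ψ := by
    simp only [tensorForm_apply, h.symm]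
  aniso ι _ t ht i := by
    simp only [tensorForm_apply] at ht
    rw [← Fintype.sum_prod_type'] at ht
    funext S
    exact h.aniso (ι × Cfg d) (fun x => t x.1 x.2) ht (i, S)
  K_symm i h1 h2 φ ψ := by
    simp [tensorForm_apply, tensorK, h.K_symm i h1 h2]
  e_adj i h1 h2 φ ψ := by
    simp only [tensorForm_apply, tensorE, tensorF, tensorK, LinearMap.coe_mk, AddHom.coe_mk,
      map_add, LinearMap.add_apply, Finset.sum_add_distrib, mul_add]
    congr 1
    · have e1 : ∀ S : Cfg d, (B (if S.Up i then φ (S.sw i) else 0)) (ψ S) =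
          if S.Up i then B (φ (S.sw i)) (ψ S) else 0 := by
        intro S; split_ifs <;> simp
      have e2 : ∀ S : Cfg d, B (φ S) (if S.Dn i then
          Kinv i (qv ^ (S.sw i).wt i • K i (ψ (S.sw i))) else 0) =
          if S.Dn i then qv * B (φ S) (ψ (S.sw i)) else 0 := by
        intro S
        split_ifs with hd
        · rw [Cfg.wt_of_up ((Cfg.up_sw_self h2 S).2 hd), map_smul, h.rep.Kinv_K i h1 h2]
          simp
        · simp
      simp only [e1, e2]
      rw [Finset.mul_sum]
      refine Finset.sum_nbij' (Cfg.sw i) (Cfg.sw i) (by simp) (by simp)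
        (fun S _ => S.sw_sw i) (fun S _ => S.sw_sw i) fun S _ => ?_
      simp only [Cfg.sw_sw, Cfg.dn_sw_self h2]
      split_ifs
      · rw [inv_mul_cancel_left₀ qv_ne_zero]
      · simp
    · rw [Finset.mul_sum]
      refine Finset.sum_congr rfl fun S _ => ?_
      simp only [map_smul, LinearMap.smul_apply, smul_eq_mul, h.e_adj i h1 h2]
      ring
  ne_zero := by simpa using h.ne_zero
  e_w i h1 h2 := by
    set S₀ : Cfg d := fun t => decide (1 ≤ t.1 ∧ t.1 ≤ a) with hS
    have hat : ∀ l ≤ d + 1, S₀.at l = decide (1 ≤ l ∧ l ≤ a) := fun l hl => by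
      simp [hS, Cfg.at, Fin.ofNat, Nat.mod_eq_of_lt (show l < d + 2 by omega)]
    funext S
    simp only [tensorE, LinearMap.coe_mk, AddHom.coe_mk, Pi.zero_apply]
    have e1 : e i (Pi.single (M := fun _ => T) S₀ w S) = 0 := by
      rcases eq_or_ne S S₀ with rfl | hne
      · simp [h.e_w i h1 h2]
      · simp [hne]
    rw [e1, smul_zero, add_zero]
    split_ifs with hu
    · rw [Pi.single_eq_of_ne]
      intro hc
      have := (Cfg.dn_sw_self h2 S).2 hu
      rw [hc, Cfg.Dn, hat _ (by omega), hat _ (by omega)] at this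
      simp at this
      omega
    · rfl
  K_w i h1 h2 := by
    set S₀ : Cfg d := fun t => decide (1 ≤ t.1 ∧ t.1 ≤ a) with hS
    have hat : ∀ l ≤ d + 1, S₀.at l = decide (1 ≤ l ∧ l ≤ a) := fun l hl => by
      simp [hS, Cfg.at, Fin.ofNat, Nat.mod_eq_of_lt (show l < d + 2 by omega)]
    have hwt : S₀.wt i = omWt a 1 i := by
      unfold Cfg.wt omWt
      rw [hat _ (by omega), hat _ (by omega)]
      simp only [decide_eq_true_eq]
      split_ifs <;> omega
    funext S
    simp only [tensorK, LinearMap.coe_mk, AddHom.coe_mk, Pi.smul_apply]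
    rcases eq_or_ne S S₀ with rfl | hne
    · simp [h.K_w i h1 h2, hwt, smul_smul, zpow_add₀ qv_ne_zero]
    · simp [hne]

end tensor

theorem exists_isUnitary {d a : ℕ} (ha : 1 ≤ a) (m : ℕ) :
    ∃ (T : Type) (_ : AddCommGroup T) (_ : Module KK T) (e f K Kinv : ℕ → Module.End KK T)
      (B : LinearMap.BilinForm KK T) (w : T), IsUnitary d e f K Kinv B (omWt a m) w := by
  induction m with
  | zero =>
    refine ⟨KK, inferInstance, inferInstance, fun _ => 0, fun _ => 0, fun _ => 1, fun _ => 1,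
      LinearMap.mul KK KK, 1, ⟨⟨?_, ?_, ?_, ?_, ?_, ?_⟩, ?_, ?_, ?_, ?_, ?_, ?_, ?_⟩⟩
    · simp
    · simp
    · simp
    · simp
    · simp
    · simp
    · exact fun x y => mul_comm x y
    · exact fun ι _ t ht => eq_zero_of_sum_mul_self_eq_zero t ht
    · simp
    · simp
    · simp
    · simp
    · simp [omWt]
  | succ m ih =>
    obtain ⟨T, _, _, e, f, K, Kinv, B, w, h⟩ := ih
    have h2 := h.tensor ha
    have h3 : (fun i => omWt a 1 i + omWt a m i) = omWt a (m + 1) := by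
      funext i
      simp only [omWt]
      push_cast
      split_ifs <;> ring
    rw [h3] at h2
    exact ⟨_, _, _, _, _, _, _, _, _, h2⟩

/-- Submodules generated by primitive vectors of a unitary module are irreducible. -/
theorem IsUnitary.fSpan_irreducible {T : Type} [AddCommGroup T] [Module KK T]
    [FiniteDimensional KK T] {b : ℕ} {e f K Kinv : ℕ → Module.End KK T}
    {B : LinearMap.BilinForm KK T} {lam : ℕ → ℤ} {w : T}
    (h : IsUnitary b e f K Kinv B lam w) {c : ℕ} (hc : c ≤ b) {z : T}
    (hz : ∀ i, 1 ≤ i → i ≤ c → e i z = 0) {X : Submodule KK T} (hX : X ≤ fSpan c f z)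
    (hXs : ∀ i, 1 ≤ i → i ≤ c → ∀ x ∈ X, e i x ∈ X ∧ f i x ∈ X ∧ K i x ∈ X ∧ Kinv i x ∈ X) :
    X = ⊥ ∨ X = fSpan c f z := by
  have hrefl : B.IsRefl := fun x y hxy => by rw [h.symm, hxy]
  have hnd : (B.restrict X).Nondegenerate := by
    constructor
    · exact fun x hx => Subtype.ext (h.self_eq_zero (hx x))
    · exact fun x hx => Subtype.ext (h.self_eq_zero (hx x))
  have hcompl := LinearMap.BilinForm.isCompl_orthogonal_of_restrict_nondegenerate hrefl hnd
  have hperp : ∀ {y}, y ∈ B.orthogonal X ↔ ∀ x ∈ X, B x y = 0 := Iff.rfl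
  obtain ⟨x, hx, x', hx', hzx⟩ := Submodule.mem_sup.1
    (show z ∈ X ⊔ B.orthogonal X from hcompl.sup_eq_top ▸ Submodule.mem_top)
  have hex : ∀ i, 1 ≤ i → i ≤ c → e i x = 0 := by
    intro i h1 h2
    have hperp' : e i x' ∈ B.orthogonal X := hperp.2 fun u hu => by
      rw [h.symm, h.e_adj i h1 (h2.trans hc), h.symm,
        hperp.1 hx' _ (hXs i h1 h2 _ (hXs i h1 h2 u hu).2.2.1).2.1, mul_zero]
    have hsum : e i x + e i x' = 0 := by rw [← map_add, hzx, hz i h1 h2]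
    refine Submodule.disjoint_def.1 hcompl.disjoint _ (hXs i h1 h2 x hx).1 ?_
    rw [eq_neg_of_add_eq_zero_left hsum]
    exact neg_mem hperp'
  obtain ⟨r, y, hy, rfl⟩ := exists_smul_add_of_mem_fSpan (hX hx)
  have hy0 : y = 0 := by
    have h1 := h.fSpanPos_orthogonal hc hex hy
    have h2 := h.fSpanPos_orthogonal hc hz hy
    refine h.self_eq_zero ?_
    simpa [h2] using h1
  subst hy0
  rw [add_zero] at hx hzx
  rcases eq_or_ne r 0 with rfl | hr
  · left
    rw [zero_smul, zero_add] at hzx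
    subst hzx
    have hle : fSpan c f x' ≤ B.orthogonal X := by
      refine fSpan_le hx' fun i h1 h2 u hu => hperp.2 fun t ht => ?_
      rw [h.symm, h.f_adj h1 (h2.trans hc), h.Kinv_symm h1 (h2.trans hc), h.symm,
        hperp.1 hu _ (hXs i h1 h2 _ (hXs i h1 h2 t ht).1).2.2.2, mul_zero]
    exact (Submodule.eq_bot_iff X).2 fun t ht =>
      Submodule.disjoint_def.1 hcompl.disjoint t ht (hle (hX ht))
  · right
    refine le_antisymm hX (fSpan_le ?_ fun i h1 h2 u hu => (hXs i h1 h2 u hu).2.1)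
    simpa [smul_smul, hr] using X.smul_mem r⁻¹ hx

/-- Restriction of the form along an embedding. -/
theorem IsUnitary.comap {T V : Type} [AddCommGroup T] [Module KK T] [AddCommGroup V] [Module KK V]
    {b : ℕ} {e f K Kinv : ℕ → Module.End KK T} {e' f' K' Kinv' : ℕ → Module.End KK V}
    {B : LinearMap.BilinForm KK T} {lam : ℕ → ℤ} {w : T} (h : IsUnitary b e f K Kinv B lam w)
    (h' : IsQRep b e' f' K' Kinv') {v : V} (hv : v ≠ 0)
    (he' : ∀ i, 1 ≤ i → i ≤ b → e' i v = 0)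
    (hK' : ∀ i, 1 ≤ i → i ≤ b → K' i v = qv ^ lam i • v) {φ : V →ₗ[KK] T}
    (hφ : Function.Injective φ) (hcomm : ∀ i, 1 ≤ i → i ≤ b → ∀ x,
      φ (e' i x) = e i (φ x) ∧ φ (f' i x) = f i (φ x) ∧ φ (K' i x) = K i (φ x)) :
    IsUnitary b e' f' K' Kinv' (B.compl₁₂ φ φ) lam v where
  rep := h'
  symm x y := h.symm _ _
  aniso ι _ t ht i := hφ (by rw [map_zero]; exact h.aniso ι (fun i => φ (t i)) ht i)
  K_symm i h1 h2 x y := by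
    simp [(hcomm i h1 h2 _).2.2, h.K_symm i h1 h2]
  e_adj i h1 h2 x y := by
    simp [(hcomm i h1 h2 _).1, (hcomm i h1 h2 _).2.1, (hcomm i h1 h2 _).2.2, h.e_adj i h1 h2]
  ne_zero := hv
  e_w := he'
  K_w := hK'

/-- The vectors `f_{a+r-1}^j ⋯ f_a^j v` for a primitive vector `v` of weight `m ω_a`: they are
nonzero weight vectors, and `e_i` annihilates them for `i ≠ a + r - 1`. -/
theorem IsQRep.chain {Z : Type} [AddCommGroup Z] [Module KK Z] [FiniteDimensional KK Z] {d : ℕ}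
    {e f K Kinv : ℕ → Module.End KK Z} (h : IsQRep d e f K Kinv) {c : KK} (hc : c ≠ 0)
    {a m j : ℕ} (ha : 1 ≤ a) (hj : j ≤ m) {u : ℕ → Z} (h0 : u 0 ≠ 0)
    (he : ∀ i, 1 ≤ i → i ≤ d → e i (u 0) = 0)
    (hK : ∀ i, 1 ≤ i → i ≤ d → K i (u 0) = qv ^ omWt a m i • u 0)
    (hu : ∀ r, u (r + 1) = c • (f (a + r) ^ j) (u r)) (r : ℕ) (hr : a + r ≤ d + 1) :
    u r ≠ 0 ∧
    (∀ i, 1 ≤ i → i ≤ d → K i (u r) = qv ^ ((if i + 1 = a then (j : ℤ) else 0) +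
      (if i = a then (m : ℤ) - j else 0) + (if i = a + r then (j : ℤ) else 0) -
      (if i + 1 = a + r then (j : ℤ) else 0)) • u r) ∧
    (∀ i, 1 ≤ i → i ≤ d → i + 1 ≠ a + r → e i (u r) = 0) ∧
    (a + r ≤ d → ∀ i, 1 ≤ i → i ≤ d → i ≠ a + r → (f (a + r) ^ j) (e i (u r)) = 0) := by
  induction r with
  | zero =>
    refine ⟨h0, fun i h1 h2 => ?_, fun i h1 h2 _ => he i h1 h2, fun _ i h1 h2 _ => ?_⟩
    · rw [hK i h1 h2, omWt]
      congr 2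
      split_ifs <;> omega
    · rw [he i h1 h2, map_zero]
  | succ r ih =>
    obtain ⟨i1, i2, i3, i4⟩ := ih (by omega)
    have hp1 : 1 ≤ a + r := by omega
    have hp2 : a + r ≤ d := by omega
    have hep : e (a + r) (u r) = 0 := i3 _ hp1 hp2 (by omega)
    have k3 : ∀ i, 1 ≤ i → i ≤ d → i ≠ a + r → e i (u (r + 1)) = 0 := by
      intro i h1 h2 hi
      rw [hu, map_smul, h.e_f_pow_of_ne h1 h2 hp1 hp2 hi, i4 hp2 i h1 h2 hi, smul_zero]
    refine ⟨?_, fun i h1 h2 => ?_, fun i h1 h2 hi => k3 i h1 h2 (by omega),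
      fun hd i h1 h2 hi => ?_⟩
    · rw [hu]
      refine smul_ne_zero hc (h.f_pow_ne_zero hp1 hp2 (i2 _ hp1 hp2) hep i1 j fun t ht => ?_)
      split_ifs <;> omega
    · rw [hu, map_smul, h.K_f_pow h1 h2 hp1 hp2 (i2 i h1 h2), smul_comm]
      congr 2
      unfold cartan
      split_ifs <;> omega
    · by_cases hia : i = a + r
      swap
      · rw [k3 i h1 h2 hia, map_zero]
      subst hia
      rw [hu, map_smul, map_smul]
      rcases j with _ | s
      · simp [hep]
      rw [h.e_f_pow hp1 hp2 (i2 _ hp1 hp2) hep, map_smul]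
      have hd' : a + (r + 1) ≤ d := hd
      have hs : (f (a + (r + 1)) ^ (s + 1)) ((f (a + r) ^ s) (u r)) = 0 := by
        refine h.f_pow_eq_zero (by omega) hd ?_ ?_
        · rw [h.K_f_pow (by omega) hd hp1 hp2 (i2 _ (by omega) hd)]
          congr 2
          unfold cartan
          split_ifs <;> omega
        · rw [h.e_f_pow_of_ne (by omega) hd hp1 hp2 (by omega), i3 _ (by omega) hd (by omega),
            map_zero]
      rw [hs, smul_zero, smul_zero]

section action

/-- the action of `G.U` on `V`. -/
def act : G.U →ₐ[KK] Module.End KK V :=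
  haveI : SMulCommClass G.U KK V := IsScalarTower.to_smulCommClass'
  Algebra.lsmul KK KK V

theorem act_apply (p : G.U) (x : V) : act G p x = p • x := rfl

theorem isQRep_act : IsQRep d (fun i => act G (V := V) (G.e i)) (fun i => act G (G.f i))
    (fun i => act G (G.K i)) (fun i => act G (G.Kinv i)) where
  K_Kinv i h1 h2 z := by
    simp only [act_apply, smul_smul, G.K_mul_Kinv i h1 h2, one_smul]
  Kinv_K i h1 h2 z := by
    simp only [act_apply, smul_smul, G.Kinv_mul_K i h1 h2, one_smul]
  K_comm i j h1 h2 h3 h4 z := by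
    simp only [act_apply, smul_smul, G.K_comm i j h1 h2 h3 h4]
  K_e i j h1 h2 h3 h4 z := by
    have := congrArg (· * G.K i) (G.K_e_Kinv i j h1 h2 h3 h4)
    simp only [mul_assoc, G.Kinv_mul_K i h1 h2, mul_one, smul_mul_assoc] at this
    simp only [act_apply, smul_smul, this]
    rw [smul_assoc]
  K_f i j h1 h2 h3 h4 z := by
    have := congrArg (· * G.K i) (G.K_f_Kinv i j h1 h2 h3 h4)
    simp only [mul_assoc, G.Kinv_mul_K i h1 h2, mul_one, smul_mul_assoc] at this
    simp only [act_apply, smul_smul, this]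
    rw [smul_assoc]
  e_f i j h1 h2 h3 h4 z := by
    have := congrArg (· • z) (G.e_f_comm i j h1 h2 h3 h4)
    simp only [act_apply, smul_smul, ← sub_smul, this]
    split_ifs
    · rw [smul_assoc]
    · rw [zero_smul]

variable {G}

theorem smul_mem_of_mem_Usub {b : ℕ} {W : Submodule KK V} (hW : ∀ i, 1 ≤ i → i ≤ b → ∀ x ∈ W,
    G.e i • x ∈ W ∧ G.f i • x ∈ W ∧ G.K i • x ∈ W ∧ G.Kinv i • x ∈ W) {p : G.U}
    (hp : p ∈ Usub G b) : ∀ x ∈ W, p • x ∈ W := by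
  induction hp using Algebra.adjoin_induction with
  | mem y hy =>
    obtain ⟨i, h1, h2, rfl | rfl | rfl | rfl⟩ := hy
    · exact fun x hx => (hW i h1 h2 x hx).1
    · exact fun x hx => (hW i h1 h2 x hx).2.1
    · exact fun x hx => (hW i h1 h2 x hx).2.2.1
    · exact fun x hx => (hW i h1 h2 x hx).2.2.2
  | algebraMap r =>
    intro x hx
    rw [algebraMap_smul]
    exact W.smul_mem r hx
  | add y z _ _ hy hz =>
    intro x hx
    rw [add_smul]
    exact add_mem (hy x hx) (hz x hx)
  | mul y z _ _ hy hz =>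
    intro x hx
    rw [mul_smul]
    exact hy _ (hz x hx)

theorem mem_USpan_iff {b : ℕ} {x w : V} : w ∈ USpan G b x ↔ ∃ p ∈ Usub G b, p • x = w := by
  refine ⟨fun hw => ?_, fun ⟨p, hp, h⟩ => Submodule.subset_span ⟨p, hp, h.symm⟩⟩
  induction hw using Submodule.span_induction with
  | mem w h => obtain ⟨p, hp, rfl⟩ := h; exact ⟨p, hp, rfl⟩
  | zero => exact ⟨0, zero_mem _, zero_smul _ _⟩
  | add y z _ _ hy hz =>
    obtain ⟨p, hp, rfl⟩ := hy
    obtain ⟨p', hp', rfl⟩ := hz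
    exact ⟨p + p', add_mem hp hp', add_smul _ _ _⟩
  | smul r y _ hy =>
    obtain ⟨p, hp, rfl⟩ := hy
    exact ⟨r • p, Subalgebra.smul_mem _ hp r, smul_assoc _ _ _⟩

theorem gen_mem_Usub {b i : ℕ} (h1 : 1 ≤ i) (h2 : i ≤ b) :
    G.e i ∈ Usub G b ∧ G.f i ∈ Usub G b ∧ G.K i ∈ Usub G b ∧ G.Kinv i ∈ Usub G b :=
  ⟨Algebra.subset_adjoin ⟨i, h1, h2, by simp⟩, Algebra.subset_adjoin ⟨i, h1, h2, by simp⟩,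
    Algebra.subset_adjoin ⟨i, h1, h2, by simp⟩, Algebra.subset_adjoin ⟨i, h1, h2, by simp⟩⟩

theorem USpan_eq_fSpan {b : ℕ} (hb : b ≤ d) {x : V} {μ : ℕ → ℤ}
    (he : ∀ i, 1 ≤ i → i ≤ b → G.e i • x = 0)
    (hK : ∀ i, 1 ≤ i → i ≤ b → G.K i • x = qv ^ μ i • x) :
    USpan G b x = fSpan b (fun i => act G (G.f i)) x := by
  have hrep := (isQRep_act G (V := V)).mono hb
  refine le_antisymm (fun w hw => ?_) (fSpan_le (mem_USpan_iff.2 ⟨1, one_mem _, one_smul _ _⟩) ?_)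
  · obtain ⟨p, hp, rfl⟩ := mem_USpan_iff.1 hw
    refine smul_mem_of_mem_Usub (fun i h1 h2 y hy => ?_) hp x self_mem_fSpan
    exact ⟨hrep.e_mem_fSpan hK he h1 h2 hy,
      f_mem_fSpan (f := fun i => act G (G.f i)) h1 h2 hy,
      hrep.K_mem_fSpan hK h1 h2 hy, hrep.Kinv_mem_fSpan hK h1 h2 hy⟩
  · intro i h1 h2 y hy
    obtain ⟨p, hp, rfl⟩ := mem_USpan_iff.1 hy
    exact mem_USpan_iff.2 ⟨G.f i * p, mul_mem (gen_mem_Usub h1 h2).2.1 hp, mul_smul _ _ _⟩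

/-- The module `V^{m ω_a}` carries an anisotropic contravariant form. -/
theorem IsHWModule.exists_isUnitary {a m : ℕ} (ha : 1 ≤ a) {v : V}
    (hV : IsHWModule G (omWt a m) v) :
    ∃ B : LinearMap.BilinForm KK V, IsUnitary d (fun i => act G (G.e i)) (fun i => act G (G.f i))
      (fun i => act G (G.K i)) (fun i => act G (G.Kinv i)) B (omWt a m) v := by
  obtain ⟨T, _, _, e, f, K, Kinv, B, w, h⟩ := QSL.exists_isUnitary (d := d) ha m
  obtain ⟨φ, hφ, hcomm⟩ := h.exists_embedding (isQRep_act G) hV.ne_zero hV.hw hV.wt <| by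
    intro W hW
    let W' : Submodule G.U V :=
      { W with smul_mem' := fun p x hx => smul_mem_of_mem_Usub hW (G.gen p) x hx }
    have hW' : ∀ x, x ∈ W' ↔ x ∈ W := fun _ => Iff.rfl
    refine (hV.irred W').imp (fun h => ?_) (fun h => ?_)
    · exact (Submodule.eq_bot_iff W).2 fun x hx => by
        rwa [← hW', h, Submodule.mem_bot] at hx
    · exact (Submodule.eq_top_iff').2 fun x => by
        rw [← hW', h]
        exact Submodule.mem_top
  exact ⟨_, h.comap (isQRep_act G) hV.ne_zero hV.hw hV.wt hφ hcomm⟩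

end action

/-- Proposition `iso`:  for `λ = m ω_a` and `0 ≤ j ≤ m`,
the `U_q(sl_{k-1})`-submodule `U_q(sl_{k-1}) v_j ⊆ V^λ` is (isomorphic to)
the irreducible highest weight `U_q(sl_{k-1})`-module with highest weight
`λ^j = j ω'_{a-1} + (m - j) ω'_a`:  `v_j` is a nonzero vector of weight `λ^j`
annihilated by `e_1, …, e_{k-2}` which generates `U_q(sl_{k-1}) v_j`, and
`U_q(sl_{k-1}) v_j` is irreducible over `U_q(sl_{k-1})`. -/
theorem submodule_is_irreducible_highest_weight
    (k a m j : ℕ) (hk : 3 ≤ k) (ha : 1 ≤ a) (hak : a ≤ k - 1) (hm : 1 ≤ m)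
    (hj : j ≤ m)
    (G : QGroup (k - 1)) (V : Type) [AddCommGroup V] [Module KK V] [Module G.U V]
    [IsScalarTower KK G.U V]
    (v : V) (hV : IsHWModule G (omWt a m) v)
    (vj : V) (hvj : vj = fDivChain G (fun _ => j) a (k - 1) v) :
    vj ≠ 0 ∧
    (∀ i, 1 ≤ i → i ≤ k - 2 → G.e i • vj = 0) ∧
    (∀ i, 1 ≤ i → i ≤ k - 2 → G.K i • vj = (qv ^ hookWt a m j i) • vj) ∧
    (∀ w ∈ USpan G (k - 2) vj, ∃ p ∈ Usub G (k - 2), p • vj = w) ∧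
    (∀ W : Submodule KK V, W ≤ USpan G (k - 2) vj →
      (∀ p ∈ Usub G (k - 2), ∀ x ∈ W, p • x ∈ W) →
      W = ⊥ ∨ W = USpan G (k - 2) vj) := by
  have := hV.findim
  set u : ℕ → V := fun n => (List.range n).foldl (fun x r => fDiv G (a + r) j • x) v with hu
  have hstep : ∀ r, u (r + 1) = (qFact j)⁻¹ • (act G (G.f (a + r)) ^ j) (u r) := by
    intro r
    simp only [hu, List.range_succ, List.foldl_append, List.foldl_cons, List.foldl_nil]
    rw [← map_pow, act_apply, fDiv, smul_assoc]
  obtain ⟨h1, h2, h3, -⟩ := (isQRep_act G (V := V)).chain (inv_ne_zero (qFact_ne_zero j)) ha hj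
    (u := u) hV.ne_zero hV.hw hV.wt hstep (k - 1 + 1 - a) (by omega)
  have hvj' : u (k - 1 + 1 - a) = vj := hvj.symm
  rw [hvj'] at h1 h2 h3
  have he : ∀ i, 1 ≤ i → i ≤ k - 2 → G.e i • vj = 0 :=
    fun i hi1 hi2 => h3 i hi1 (by omega) (by omega)
  have hK : ∀ i, 1 ≤ i → i ≤ k - 2 → G.K i • vj = qv ^ hookWt a m j i • vj := by
    intro i hi1 hi2
    rw [← act_apply, h2 i hi1 (by omega), hookWt]
    congr 2
    split_ifs <;> omega
  refine ⟨h1, he, hK, fun w hw => mem_USpan_iff.1 hw, fun W hW hWs => ?_⟩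
  obtain ⟨B, hB⟩ := hV.exists_isUnitary ha
  rw [USpan_eq_fSpan (by omega) he hK] at hW ⊢
  exact hB.fSpan_irreducible (by omega) he hW fun i hi1 hi2 x hx =>
    have hg := gen_mem_Usub (G := G) hi1 hi2
    ⟨hWs _ hg.1 x hx, hWs _ hg.2.1 x hx, hWs _ hg.2.2.1 x hx, hWs _ hg.2.2.2 x hx⟩

end QSL
end
end

section
/- Let k ≥ 3, 1 ≤ a ≤ k−1, m ≥ 1, and 0 ≤ j ≤ m. Let λ = (m^a) and λ^j = (m^{a−1}, m−j) (a−1 rows of length m and one row of length m−j). For b ∈ SSYT(λ^j, k−1), let φ_j(b) ∈ SSYT(λ, k) be the tableau obtained from b by appending j boxes, each with entry k, at the right end of row a. Then: (i) T_j := f̃_{k−1}^j f̃_{k−2}^j ⋯ f̃_a^j (T_λ) = φ_j(T_{λ^j}); and (ii) for every r ≥ 0 and every sequence i_1, …, i_r ∈ {1, …, k−2}, if f̃_{i_r} ⋯ f̃_{i_1}(T_{λ^j}) ≠ 0, then f̃_{i_r} ⋯ f̃_{i_1}(T_j) = φ_j( f̃_{i_r} ⋯ f̃_{i_1}(T_{λ^j})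 ). -/
/-!
Semistandard Young tableaux are encoded by their "reading words"
`w : ℕ → ℕ`:  the boxes of the shape `μ` are labelled `1, …, |μ|`, the boxes
of row `i` (`i = 1, 2, …`) receiving the labels
`μ₁ + ⋯ + μ_{i-1} + 1, …, μ₁ + ⋯ + μ_i`, increasing from right to left within
each row, and `w j` is the entry of the box labelled `j` (with `w j = 0`
outside the labels `1, …, |μ|`).  A vanished tableau (`0`) is represented by
`none : Option (ℕ → ℕ)`.
-/

namespace CST

/-- `μ₁ + ⋯ + μ_r`. -/
def shapePrefix (μ : List ℕ) (r : ℕ) : ℕ := (μ.take r).sum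

/-- The entry of the filling with reading word `w` in row `r + 1` and column
`c` (columns numbered from the left, `1 ≤ c ≤ μ_{r+1}`). -/
def entryAt (μ : List ℕ) (w : ℕ → ℕ) (r c : ℕ) : ℕ :=
  w (shapePrefix μ r + μ.getD r 0 + 1 - c)

/-- `w` is the reading word of a semistandard Young tableau of shape `μ` with
entries in `{1, …, k}`: entries lie in `{1, …, k}`, rows weakly increase,
columns strictly increase, and `w` vanishes outside the labels `1, …, |μ|`. -/
def IsSSYT (μ : List ℕ) (k : ℕ) (w : ℕ → ℕ) : Prop :=
  (∀ r c, r < μ.length → 1 ≤ c → c ≤ μ.getD r 0 →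
      1 ≤ entryAt μ w r c ∧ entryAt μ w r c ≤ k) ∧
  (∀ r c, r < μ.length → 1 ≤ c → c < μ.getD r 0 →
      entryAt μ w r c ≤ entryAt μ w r (c + 1)) ∧
  (∀ r c, r + 1 < μ.length → 1 ≤ c → c ≤ μ.getD (r + 1) 0 →
      entryAt μ w r c < entryAt μ w (r + 1) c) ∧
  (∀ j, j = 0 ∨ μ.sum < j → w j = 0)

/-- One step of the bracketing procedure for the letters `i, i + 1`:  `acc`
is the stack of labels of currently unmatched letters `i` (most recent
first); a letter `i + 1` matches (and removes) the most recent unmatched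
`i`. -/
def scanStep (i : ℕ) (w : ℕ → ℕ) (acc : List ℕ) (j : ℕ) : List ℕ :=
  if w j = i then j :: acc
  else if w j = i + 1 then acc.drop 1
  else acc

/-- The labels of the unmatched letters `i` of `w` after the iterated removal
of consecutive pairs `i … i+1` (scanning the labels `1, …, n` in order). -/
def unmatched (n i : ℕ) (w : ℕ → ℕ) : List ℕ :=
  ((List.range n).map (· + 1)).foldl (scanStep i w) []

/-- The Kashiwara lowering operator `f̃ᵢ` on fillings with `n` boxes:  if
some letter `i` is unmatched, change the one with the smallest label to
`i + 1`; otherwise the result is `0` (i.e. `none`). -/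
def fTilde (n i : ℕ) : Option (ℕ → ℕ) → Option (ℕ → ℕ)
  | none => none
  | some w =>
    match (unmatched n i w).min? with
    | none => none
    | some j => some (Function.update w j (i + 1))

/-- `f̃_{a'}^{c_{a'}} ⋯ f̃_{a+1}^{c_{a+1}} f̃_a^{c_a} T`. -/
def chainPow (n : ℕ) (c : ℕ → ℕ) (a a' : ℕ) (T : Option (ℕ → ℕ)) : Option (ℕ → ℕ) :=
  (List.range (a' + 1 - a)).foldl (fun t r => (fTilde n (a + r))^[c (a + r)] t) T

/-- `f̃_{i_r} ⋯ f̃_{i_1} T` for `is = [i_1, …, i_r]`. -/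
def applySeq (n : ℕ) (is : List ℕ) (T : Option (ℕ → ℕ)) : Option (ℕ → ℕ) :=
  is.foldl (fun t i => fTilde n i t) T

/-- The highest weight tableau `T_μ`: every entry of row `i` equals `i`. -/
def highestWord (μ : List ℕ) (j : ℕ) : ℕ :=
  if 1 ≤ j ∧ j ≤ μ.sum then
    ((List.range μ.length).filter fun r => shapePrefix μ (r + 1) < j).length + 1
  else 0

/-- the map `φ_j` on reading words:  `φ_j(b)` is obtained from the tableau
`b` of shape `λ^j = (m^{a-1}, m-j)` by appending `j` boxes with entry `k` at
the right end of row `a`; in the labelling of the rectangle `(m^a)` the new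
boxes receive the labels `(a-1)m + 1, …, (a-1)m + j` and the labels of the
boxes of row `a` of `b` are shifted up by `j`. -/
def phiWord (a m j k : ℕ) (w : ℕ → ℕ) : ℕ → ℕ := fun l =>
  if l = 0 then 0
  else if l ≤ (a - 1) * m then w l
  else if l ≤ (a - 1) * m + j then k
  else if l ≤ a * m then w (l - j)
  else 0

theorem map_add_one_range (n : ℕ) : (List.range n).map (· + 1) = List.range' 1 n := by
  simp only [List.range'_eq_map_range, add_comm]

theorem unmatched_eq_foldl (n i : ℕ) (w : ℕ → ℕ) :
    unmatched n i w = (List.range' 1 n).foldl (scanStep i w) [] := by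
  rw [unmatched, map_add_one_range]

theorem foldl_scanStep_map {i : ℕ} {w v σ : ℕ → ℕ} (L acc : List ℕ)
    (h : ∀ l ∈ L, v (σ l) = w l) :
    (L.map σ).foldl (scanStep i v) (acc.map σ) = (L.foldl (scanStep i w) acc).map σ := by
  induction L generalizing acc with
  | nil => rfl
  | cons x L ih =>
    have hx : scanStep i v (acc.map σ) (σ x) = (scanStep i w acc x).map σ := by
      simp only [scanStep, h x (by simp)]
      split_ifs <;> simp
    simp only [List.map_cons, List.foldl_cons, hx]
    exact ih _ fun l hl => h l (by simp [hl])

theorem foldl_scanStep_eq_self {i : ℕ} {w : ℕ → ℕ} (L acc : List ℕ)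
    (h : ∀ l ∈ L, w l ≠ i ∧ w l ≠ i + 1) : L.foldl (scanStep i w) acc = acc := by
  induction L with
  | nil => rfl
  | cons x L ih =>
    have hx := h x (by simp)
    simpa [scanStep, hx.1, hx.2] using ih fun l hl => h l (by simp [hl])

theorem foldl_scanStep_nil {i : ℕ} {w : ℕ → ℕ} (L : List ℕ) (h : ∀ l ∈ L, w l ≠ i) :
    L.foldl (scanStep i w) [] = [] := by
  induction L with
  | nil => rfl
  | cons x L ih =>
    simpa [scanStep, h x (by simp)] using ih fun l hl => h l (by simp [hl])

theorem min?_foldl_scanStep {i q : ℕ} {w : ℕ → ℕ} (L acc : List ℕ)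
    (h : ∀ l ∈ L, w l ≠ i + 1 ∧ q ≤ l) (hacc : acc.min? = some q) :
    (L.foldl (scanStep i w) acc).min? = some q := by
  induction L generalizing acc with
  | nil => exact hacc
  | cons x L ih =>
    refine ih _ (fun l hl => h l (by simp [hl])) ?_
    obtain ⟨hx, hq⟩ := h x (by simp)
    rw [scanStep]
    split_ifs
    · simp [List.min?_cons, hacc, hq]
    · exact hacc

theorem min?_map_of_monotone {σ : ℕ → ℕ} (hσ : Monotone σ) (L : List ℕ) :
    (L.map σ).min? = L.min?.map σ := by
  induction L with
  | nil => rfl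
  | cons x L ih =>
    rw [List.map_cons, List.min?_cons, List.min?_cons, ih]
    cases L.min? <;> simp [hσ.map_min]

theorem range'_split {q n : ℕ} (hq : 1 ≤ q) (hqn : q ≤ n) :
    List.range' 1 n = List.range' 1 (q - 1) ++ q :: List.range' (q + 1) (n - q) := by
  obtain ⟨d, rfl⟩ := Nat.exists_eq_add_of_le hqn
  obtain ⟨p, rfl⟩ := Nat.exists_eq_add_of_le hq
  rw [show 1 + p + d = p + (d + 1) by omega, ← List.range'_append_1, List.range'_succ]
  congr 3 <;> omega

/-- If the first letter `i` has label `q` and no letter `i + 1` follows it, then `f̃ᵢ` acts on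
the label `q`. -/
theorem fTilde_eq_update {n i q : ℕ} {w : ℕ → ℕ} (hq : 1 ≤ q) (hqn : q ≤ n)
    (hlt : ∀ l, 1 ≤ l → l < q → w l ≠ i) (hwq : w q = i)
    (hgt : ∀ l, q < l → w l ≠ i + 1) :
    fTilde n i (some w) = some (Function.update w q (i + 1)) := by
  have h : (unmatched n i w).min? = some q := by
    rw [unmatched_eq_foldl, range'_split hq hqn, List.foldl_append, List.foldl_cons,
      foldl_scanStep_nil _ fun l hl => ?_]
    · refine min?_foldl_scanStep _ _ (fun l hl => ?_) ?_
      · rw [List.mem_range'_1] at hl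
        exact ⟨hgt l (by omega), by omega⟩
      · simp [scanStep, hwq]
    · rw [List.mem_range'_1] at hl
      exact hlt l (by omega) (by omega)
  simp [fTilde, h]

/-- The word `w` with the letters labelled `p + 1, …, p + t` replaced by `x`. -/
def setBlock (p t x : ℕ) (w : ℕ → ℕ) : ℕ → ℕ := fun l => if p < l ∧ l ≤ p + t then x else w l

theorem fTilde_iterate_eq_setBlock {n i p t : ℕ} {w : ℕ → ℕ} (hn : p + t ≤ n)
    (hlt : ∀ l, 1 ≤ l → l ≤ p → w l ≠ i) (hblock : ∀ l, p < l → l ≤ p + t → w l = i)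
    (hgt : ∀ l, p < l → w l ≠ i + 1) :
    (fTilde n i)^[t] (some w) = some (setBlock p t (i + 1) w) := by
  induction t with
  | zero =>
    have : setBlock p 0 (i + 1) w = w := by
      funext l
      exact if_neg (by omega)
    simp [this]
  | succ t ih =>
    rw [Function.iterate_succ_apply',
      ih (by omega) (fun l h1 h2 => hblock l h1 (by omega)),
      fTilde_eq_update (q := p + t + 1) (by omega) (by omega)]
    · congr 1
      funext l
      by_cases hl : l = p + t + 1
      · subst hl
        simp only [Function.update_self, setBlock]
        rw [if_pos (by omega)]
      · simp only [Function.update_of_ne hl, setBlock]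
        congr 1
        apply propext
        omega
    · intro l h1 h2
      simp only [setBlock]
      split_ifs with h
      · omega
      · exact hlt l h1 (by omega)
    · simp only [setBlock]
      rw [if_neg (by omega), hblock _ (by omega) (by omega)]
    · intro l h
      simp only [setBlock]
      rw [if_neg (by omega)]
      exact hgt l (by omega)

theorem chain_eq_setBlock {n a p j : ℕ} {w : ℕ → ℕ} (hn : p + j ≤ n)
    (hlt : ∀ l, 1 ≤ l → l ≤ p → w l < a) (hblock : ∀ l, p < l → l ≤ p + j → w l = a)
    (hle : ∀ l, w l ≤ a) (d : ℕ) :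
    (List.range d).foldl (fun t r => (fTilde n (a + r))^[j] t) (some w)
      = some (setBlock p j (a + d) w) := by
  induction d with
  | zero =>
    simp only [List.range_zero, List.foldl_nil, add_zero, Option.some.injEq]
    funext l
    simp only [setBlock]
    split_ifs with h
    · exact hblock l h.1 h.2
    · rfl
  | succ d ih =>
    rw [List.range_succ, List.foldl_append, ih, List.foldl_cons, List.foldl_nil,
      fTilde_iterate_eq_setBlock (p := p) hn]
    · congr 1
      funext l
      simp only [setBlock]
      split_ifs <;> rfl
    · intro l h1 h2
      have := hlt l h1 h2
      simp only [setBlock]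
      rw [if_neg (by omega)]
      omega
    · intro l h1 h2
      exact if_pos ⟨h1, h2⟩
    · intro l _
      have := hle l
      simp only [setBlock]
      split_ifs <;> omega

section HighestWord

variable (b m s : ℕ)

theorem shapePrefix_replicate_append {r : ℕ} (hr : r ≤ b) :
    shapePrefix (List.replicate b m ++ [s]) r = r * m := by
  rw [shapePrefix, List.take_append_of_le_length (by simpa using hr)]
  simp [hr]

theorem highestWord_replicate_append {l : ℕ} (h1 : 1 ≤ l) (h2 : l ≤ b * m + s) :
    highestWord (List.replicate b m ++ [s]) l
      = ((List.range b).filter fun r => (r + 1) * m < l).length + 1 := by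
  have hb : shapePrefix (List.replicate b m ++ [s]) (b + 1) = b * m + s := by
    rw [shapePrefix, List.take_of_length_le (by simp)]
    simp
  rw [highestWord, if_pos (by simpa using ⟨h1, h2⟩)]
  simp only [List.length_append, List.length_replicate, List.length_singleton,
    List.range_succ, List.filter_append]
  rw [List.filter_congr (l := List.range b) (q := fun r => (r + 1) * m < l)]
  · simp [hb, h2]
  · intro r hr
    rw [List.mem_range] at hr
    rw [shapePrefix_replicate_append b m s (by omega)]

theorem highestWord_eq_last {l : ℕ} (h1 : b * m < l) (h2 : l ≤ b * m + s) :
    highestWord (List.replicate b m ++ [s]) l = b + 1 := by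
  rw [highestWord_replicate_append b m s (by omega) h2, List.filter_eq_self.2]
  · simp
  · intro r hr
    rw [List.mem_range] at hr
    have : (r + 1) * m ≤ b * m := Nat.mul_le_mul_right m hr
    simp only [decide_eq_true_eq]
    omega

theorem highestWord_lt_last {l : ℕ} (h1 : 1 ≤ l) (h2 : l ≤ b * m) :
    highestWord (List.replicate b m ++ [s]) l < b + 1 := by
  rw [highestWord_replicate_append b m s h1 (by omega)]
  have hb : 1 ≤ b := by
    rcases Nat.eq_zero_or_pos b with rfl | hb
    · omega
    · exact hb
  have := (List.length_filter_lt_length_iff_exists (l := List.range b)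
    (p := fun r => decide ((r + 1) * m < l))).2
    ⟨b - 1, by simp; omega, by simpa [Nat.sub_add_cancel hb] using h2⟩
  simpa using this

theorem highestWord_eq_zero {l : ℕ} (h : l = 0 ∨ b * m + s < l) :
    highestWord (List.replicate b m ++ [s]) l = 0 := by
  rw [highestWord, if_neg]
  simp
  omega

theorem highestWord_le_last (l : ℕ) : highestWord (List.replicate b m ++ [s]) l ≤ b + 1 := by
  by_cases h0 : l = 0 ∨ b * m + s < l
  · simp [highestWord_eq_zero b m s h0]
  · by_cases h1 : l ≤ b * m
    · exact (highestWord_lt_last b m s (by omega) h1).le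
    · exact (highestWord_eq_last b m s (by omega) (by omega)).le

end HighestWord

theorem setBlock_highestWord_eq_phiWord {b m j : ℕ} (k : ℕ) (hj : j ≤ m) :
    setBlock (b * m) j k (highestWord (List.replicate b m ++ [m]))
      = phiWord (b + 1) m j k (highestWord (List.replicate b m ++ [m - j])) := by
  funext l
  have hsucc : (b + 1) * m = b * m + m := Nat.succ_mul b m
  simp only [setBlock, phiWord, Nat.add_sub_cancel, hsucc]
  split_ifs <;> try omega
  · exact highestWord_eq_zero b m m (by omega)
  · rw [highestWord_replicate_append b m m (by omega) (by omega),
      highestWord_replicate_append b m (m - j) (by omega) (by omega)]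
  · rw [highestWord_eq_last b m m (by omega) (by omega),
      highestWord_eq_last b m (m - j) (by omega) (by omega)]
  · exact highestWord_eq_zero b m m (by omega)

/-- The relabelling of boxes induced by inserting `j` new labels after the label `p`. -/
def shiftLabel (p j l : ℕ) : ℕ := if l ≤ p then l else l + j

theorem shiftLabel_monotone (p j : ℕ) : Monotone (shiftLabel p j) := by
  intro x y h
  simp only [shiftLabel]
  split_ifs <;> omega

theorem phiWord_shiftLabel {b m j k l : ℕ} (hj : j ≤ m) (w : ℕ → ℕ) (h1 : 1 ≤ l)
    (h2 : l ≤ b * m + (m - j)) :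
    phiWord (b + 1) m j k w (shiftLabel (b * m) j l) = w l := by
  have hsucc : (b + 1) * m = b * m + m := Nat.succ_mul b m
  simp only [shiftLabel, phiWord, Nat.add_sub_cancel, hsucc]
  split_ifs <;> first | omega | simp

theorem unmatched_phiWord {b m j k i : ℕ} (hj : j ≤ m) (hi : i + 1 < k) (w : ℕ → ℕ) :
    unmatched ((b + 1) * m) i (phiWord (b + 1) m j k w)
      = (unmatched ((b + 1) * m - j) i w).map (shiftLabel (b * m) j) := by
  have hsucc : (b + 1) * m = b * m + m := Nat.succ_mul b m
  have hshort : List.range' 1 (b * m + m - j)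
      = List.range' 1 (b * m) ++ List.range' (1 + b * m) (m - j) := by
    rw [List.range'_append_1]
    congr 1
    omega
  have hlong : List.range' 1 (b * m + m)
      = (List.range' 1 (b * m)).map (shiftLabel (b * m) j) ++ List.range' (1 + b * m) j
        ++ (List.range' (1 + b * m) (m - j)).map (shiftLabel (b * m) j) := by
    have hl : (List.range' 1 (b * m)).map (shiftLabel (b * m) j) = List.range' 1 (b * m) := by
      refine (List.map_congr_left fun l hl => ?_).trans (List.map_id _)
      rw [List.mem_range'_1] at hl
      exact if_pos (by omega)
    have hr : (List.range' (1 + b * m) (m - j)).map (shiftLabel (b * m) j)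
        = List.range' (1 + (b * m + j)) (m - j) := by
      rw [show 1 + (b * m + j) = j + (1 + b * m) by omega,
        ← List.map_add_range' (1 + b * m) (m - j) 1]
      refine List.map_congr_left fun l hl => ?_
      rw [List.mem_range'_1] at hl
      rw [shiftLabel, if_neg (by omega), add_comm]
    rw [hl, hr, List.range'_append_1, List.range'_append_1]
    congr 1
    omega
  rw [unmatched_eq_foldl, unmatched_eq_foldl, hsucc, hshort, hlong, List.foldl_append,
    List.foldl_append, List.foldl_append, ← foldl_scanStep_map (v := phiWord (b + 1) m j k w),
    ← foldl_scanStep_map (v := phiWord (b + 1) m j k w), List.map_nil,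
    foldl_scanStep_eq_self (List.range' (1 + b * m) j)]
  · intro l hl
    rw [List.mem_range'_1] at hl
    have : phiWord (b + 1) m j k w l = k := by
      simp only [phiWord, Nat.add_sub_cancel]
      rw [if_neg (by omega), if_neg (by omega), if_pos (by omega)]
    omega
  all_goals
    intro l hl
    rw [List.mem_range'_1] at hl
    exact phiWord_shiftLabel hj w (by omega) (by omega)

theorem update_phiWord {b m j k l : ℕ} (hj : j ≤ m) (w : ℕ → ℕ) (x : ℕ) (h1 : 1 ≤ l)
    (h2 : l ≤ b * m + (m - j)) :
    Function.update (phiWord (b + 1) m j k w) (shiftLabel (b * m) j l) x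
      = phiWord (b + 1) m j k (Function.update w l x) := by
  have hsucc : (b + 1) * m = b * m + m := Nat.succ_mul b m
  funext y
  simp only [Function.update_apply, shiftLabel, phiWord, Nat.add_sub_cancel, hsucc]
  split_ifs <;> first | rfl | omega

theorem mem_of_mem_foldl_scanStep {i : ℕ} {w : ℕ → ℕ} {x : ℕ} (L acc : List ℕ)
    (hx : x ∈ L.foldl (scanStep i w) acc) : x ∈ L ∨ x ∈ acc := by
  induction L generalizing acc with
  | nil => exact .inr hx
  | cons y L ih =>
    rcases ih _ hx with h | h
    · simp [h]
    · rw [scanStep] at h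
      split_ifs at h
      · rcases List.mem_cons.1 h with rfl | h
        · simp
        · exact .inr h
      · exact .inr (List.mem_of_mem_drop h)
      · exact .inr h

theorem fTilde_phiWord {b m j k i : ℕ} (hj : j ≤ m) (hi : i + 1 < k) (w : ℕ → ℕ) :
    fTilde ((b + 1) * m) i (some (phiWord (b + 1) m j k w))
      = (fTilde ((b + 1) * m - j) i (some w)).map (phiWord (b + 1) m j k) := by
  have hsucc : (b + 1) * m = b * m + m := Nat.succ_mul b m
  simp only [fTilde, unmatched_phiWord hj hi, min?_map_of_monotone (shiftLabel_monotone _ _)]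
  rcases h : (unmatched ((b + 1) * m - j) i w).min? with _ | l
  · rfl
  · have hl := List.min?_mem h
    rw [unmatched_eq_foldl] at hl
    have hl' := (mem_of_mem_foldl_scanStep _ _ hl).resolve_right (by simp)
    rw [List.mem_range'_1] at hl'
    simp only [Option.map_some]
    rw [update_phiWord hj w _ (by omega) (by omega)]

theorem applySeq_phiWord {b m j k : ℕ} (hj : j ≤ m) (is : List ℕ)
    (his : ∀ i ∈ is, i + 1 < k) (T : Option (ℕ → ℕ)) :
    applySeq ((b + 1) * m) is (T.map (phiWord (b + 1) m j k))
      = (applySeq ((b + 1) * m - j) is T).map (phiWord (b + 1) m j k) := by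
  induction is generalizing T with
  | nil => rfl
  | cons i is ih =>
    have hstep : fTilde ((b + 1) * m) i (T.map (phiWord (b + 1) m j k))
        = (fTilde ((b + 1) * m - j) i T).map (phiWord (b + 1) m j k) := by
      cases T with
      | none => rfl
      | some w => exact fTilde_phiWord hj (his i (by simp)) w
    simp only [applySeq, List.foldl_cons, hstep]
    exact ih (fun i hi => his i (by simp [hi])) _

/-- Lemma `in`:  let `λ = (m^a)` (`1 ≤ a ≤ k - 1`),
`0 ≤ j ≤ m` and `λ^j = (m^{a-1}, m - j)`.  Then:
(i) `T_j := f̃_{k-1}^j ⋯ f̃_a^j (T_λ) = φ_j(T_{λ^j})`; and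
(ii) for every sequence `i_1, …, i_r ∈ {1, …, k-2}`, if
`f̃_{i_r} ⋯ f̃_{i_1}(T_{λ^j}) ≠ 0`, then
`f̃_{i_r} ⋯ f̃_{i_1}(T_j) = φ_j(f̃_{i_r} ⋯ f̃_{i_1}(T_{λ^j}))`. -/
theorem phi_intertwines_kashiwara_operators
    (k a m j : ℕ) (hk : 3 ≤ k) (ha : 1 ≤ a) (hak : a ≤ k - 1) (hm : 1 ≤ m)
    (hj : j ≤ m) :
    chainPow (a * m) (fun _ => j) a (k - 1)
        (some (highestWord (List.replicate a m)))
      = some (phiWord a m j k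
          (highestWord (List.replicate (a - 1) m ++ [m - j]))) ∧
    (∀ is : List ℕ, (∀ i ∈ is, 1 ≤ i ∧ i ≤ k - 2) →
      ∀ w' : ℕ → ℕ,
        applySeq (a * m - j) is
            (some (highestWord (List.replicate (a - 1) m ++ [m - j]))) = some w' →
        applySeq (a * m) is
            (some (phiWord a m j k
              (highestWord (List.replicate (a - 1) m ++ [m - j]))))
          = some (phiWord a m j k w')) := by
  obtain ⟨b, rfl⟩ : ∃ b, a = b + 1 := ⟨a - 1, by omega⟩
  have hsucc : (b + 1) * m = b * m + m := Nat.succ_mul b m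
  rw [Nat.add_sub_cancel]
  refine ⟨?_, fun is his w' hw' => ?_⟩
  · rw [List.replicate_succ', chainPow,
      chain_eq_setBlock (p := b * m) (by omega) (fun l => highestWord_lt_last b m m)
        (fun l h1 h2 => highestWord_eq_last b m m h1 (by omega)) (highestWord_le_last b m m),
      show b + 1 + (k - 1 + 1 - (b + 1)) = k by omega, setBlock_highestWord_eq_phiWord k hj]
  · have hlt : ∀ i ∈ is, i + 1 < k := fun i hi => by
      have := his i hi
      omega
    simpa [hw'] using applySeq_phiWord (b := b) hj is hlt
      (some (highestWord (List.replicate b m ++ [m - j])))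

end CST
end
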